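/- Let a and b be square-free positive integers with gcd(a,b) ≤ 2. Then the indefinite quaternary quadratic form f(x₀,y₁,y₂,y₃) = x₀² − a·y₁² − b·y₂² − a·b·y₃² is universal: for every integer d there exist integers x₀, y₁, y₂, y₃ with f(x₀,y₁,y₂,y₃) = d. -/

import Mathlib

set_option maxHeartbeats 800000 in
/-- The theorem of Legendre in a special case, by pigeonhole. -/
theorem legendre_aux (A B : ℤ) (hAB : IsCoprime A B) (hB : 0 < B) (hA0 : A ≠ 0) (hA1 : A ≠ -1)
    (α β : ℤ) (hα : B ∣ α ^ 2 - A) (hβ : A ∣ β ^ 2 - B) :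
    ∃ x y z : ℤ, (x ≠ 0 ∨ y ≠ 0 ∨ z ≠ 0) ∧ x ^ 2 = A * y ^ 2 + B * z ^ 2 := by
  by_cases hBs : IsSquare B
  · obtain ⟨r, hr⟩ := hBs
    exact ⟨r, 0, 1, by simp, by rw [hr]; ring⟩
  by_cases hAs : IsSquare A
  · obtain ⟨r, hr⟩ := hAs
    exact ⟨r, 1, 0, by simp, by rw [hr]; ring⟩
  obtain ⟨b, rfl⟩ : ∃ b : ℕ, B = b := ⟨B.toNat, by omega⟩
  set a := A.natAbs with ha
  have ha0 : a ≠ 0 := by simpa [ha] using hA0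
  have hb0 : b ≠ 0 := by omega
  have : NeZero a := ⟨ha0⟩
  have : NeZero b := ⟨hb0⟩
  let key : Fin (Nat.sqrt (a*b) + 1) × Fin (Nat.sqrt b + 1) × Fin (Nat.sqrt a + 1) → ZMod b × ZMod a :=
    fun p => (((p.1 : ℤ) - α * (p.2.1 : ℤ) : ℤ), ((p.1 : ℤ) - β * (p.2.2 : ℤ) : ℤ))
  have hcard : Fintype.card (ZMod b × ZMod a) < Fintype.card (Fin (Nat.sqrt (a*b) + 1) × Fin (Nat.sqrt b + 1) × Fin (Nat.sqrt a + 1)) := by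
    simp only [Fintype.card_prod, ZMod.card, Fintype.card_fin]
    have h1 := Nat.lt_succ_sqrt (a*b)
    have h2 := Nat.lt_succ_sqrt b
    have h3 := Nat.lt_succ_sqrt a
    simp only [Nat.succ_eq_add_one] at h1 h2 h3
    set r := Nat.sqrt (a*b) + 1
    set s := Nat.sqrt b + 1
    set t := Nat.sqrt a + 1
    have h4 : a * b < (s * t) * (s * t) := by
      calc a * b < (t*t) * (s*s) := Nat.mul_lt_mul'' h3 h2
        _ = _ := by ring
    have h5 : (a*b) * (a*b) < (r * (s*t)) * (r*(s*t)) := by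
      calc (a*b) * (a*b) < (r*r) * ((s * t) * (s * t)) := Nat.mul_lt_mul'' h1 h4
        _ = _ := by ring
    have := Nat.mul_self_lt_mul_self_iff.1 h5
    rw [mul_comm b a]; exact this
  obtain ⟨p, q, hpq, hk⟩ := Fintype.exists_ne_map_eq_of_card_lt key hcard
  obtain ⟨⟨x1, hx1⟩, ⟨y1, hy1⟩, ⟨z1, hz1⟩⟩ := p
  obtain ⟨⟨x2, hx2⟩, ⟨y2, hy2⟩, ⟨z2, hz2⟩⟩ := q
  simp only [key, Prod.mk.injEq] at hk
  obtain ⟨hk1, hk2⟩ := hk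
  rw [ZMod.intCast_eq_intCast_iff_dvd_sub] at hk1 hk2
  have hka : A ∣ (x2 - β * z2) - ((x1:ℤ) - β * z1) := by
    rw [← Int.natAbs_dvd]; exact hk2
  obtain ⟨x, hx⟩ : ∃ x : ℤ, x = x2 - x1 := ⟨_, rfl⟩
  obtain ⟨y, hy⟩ : ∃ x : ℤ, x = y2 - y1 := ⟨_, rfl⟩
  obtain ⟨z, hz⟩ : ∃ x : ℤ, x = z2 - z1 := ⟨_, rfl⟩
  have hne : x ≠ 0 ∨ y ≠ 0 ∨ z ≠ 0 := by
    by_contra! h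
    apply hpq
    simp only [Prod.mk.injEq, Fin.mk.injEq]
    omega
  have hkb' : (b:ℤ) ∣ x - α * y := by
    have : x - α * y = (x2 - α * y2) - ((x1:ℤ) - α * y1) := by rw [hx, hy]; ring
    rw [this]; exact hk1
  have hka' : A ∣ x - β * z := by
    have : x - β * z = (x2 - β * z2) - ((x1:ℤ) - β * z1) := by rw [hx, hz]; ring
    rw [this]; exact hka
  have hdb : (b:ℤ) ∣ x^2 - A * y^2 - b * z^2 := by
    have : x^2 - A * y^2 - b * z^2 = (x - α * y) * (x + α * y) + (α^2 - A) * y^2 - b * z^2 := by ring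
    rw [this]
    exact dvd_sub (dvd_add (hkb'.mul_right _) (hα.mul_right _)) (dvd_mul_right _ _)
  have hda : A ∣ x^2 - A * y^2 - b * z^2 := by
    have : x^2 - A * y^2 - b * z^2 = (x - β * z) * (x + β * z) + (β^2 - b) * z^2 - A * y^2 := by ring
    rw [this]
    exact dvd_sub (dvd_add (hka'.mul_right _) (hβ.mul_right _)) (dvd_mul_right _ _)
  obtain ⟨k, hk⟩ := hAB.mul_dvd hda hdb
  have hx2b : x^2 ≤ a * b := by
    have h1 := Nat.sqrt_le (a*b)
    have : |x| ≤ (Nat.sqrt (a*b) : ℤ) := by rw [abs_le]; omega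
    calc x^2 = |x| * |x| := by rw [← sq, sq_abs]
      _ ≤ (Nat.sqrt (a*b) : ℤ) * (Nat.sqrt (a*b) : ℤ) := by gcongr
      _ ≤ a * b := by exact_mod_cast h1
  have hy2b : y^2 < b := by
    have h1 := Nat.sqrt_le b
    have : |y| ≤ (Nat.sqrt b : ℤ) := by rw [abs_le]; omega
    have h2 : y^2 ≤ b := by
      calc y^2 = |y| * |y| := by rw [← sq, sq_abs]
        _ ≤ (Nat.sqrt b : ℤ) * (Nat.sqrt b : ℤ) := by gcongr
        _ ≤ b := by exact_mod_cast h1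
    refine lt_of_le_of_ne h2 (fun h => hBs ⟨y, by rw [← h]; ring⟩)
  have hz2b : z^2 ≤ a := by
    have h1 := Nat.sqrt_le a
    have : |z| ≤ (Nat.sqrt a : ℤ) := by rw [abs_le]; omega
    calc z^2 = |z| * |z| := by rw [← sq, sq_abs]
      _ ≤ (Nat.sqrt a : ℤ) * (Nat.sqrt a : ℤ) := by gcongr
      _ ≤ a := by exact_mod_cast h1
  have haZ : (0:ℤ) < a := by exact_mod_cast Nat.pos_of_ne_zero ha0
  suffices hfin : k = -1 ∨ k = 0 by
    rcases hfin with hk1 | hk1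
    · refine ⟨x * z + A * y, x + y * z, z^2 - A, Or.inr (Or.inr ?_), ?_⟩
      · intro h
        exact hAs ⟨z, by linarith⟩
      · rw [hk1] at hk
        linear_combination (z^2 - A) * hk
    · refine ⟨x, y, z, hne, ?_⟩
      rw [hk1] at hk
      linear_combination hk
  have hab : (0:ℤ) < a * b := mul_pos haZ hB
  have e1 : (a:ℤ) * y^2 ≤ a * b - a := by nlinarith only [hy2b, haZ]
  have e2 : (b:ℤ) * z^2 ≤ a * b := by nlinarith only [hz2b, hB]
  have e3 : 0 ≤ (a:ℤ) * y^2 := by positivity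
  have e4 : 0 ≤ (b:ℤ) * z^2 := by positivity
  have e5 := sq_nonneg x
  rcases lt_or_gt_of_ne hA0 with hneg | hpos
  · have hAa : A = -a := by omega
    have hk' : x^2 + a * y^2 - b * z^2 = -(a * b * k) := by
      rw [hAa] at hk; linear_combination hk
    have : -(2:ℤ) < k := by
      by_contra! h
      have h' : (2:ℤ) ≤ -k := by omega
      have := mul_le_mul_of_nonneg_left h' hab.le
      nlinarith only [this, hk', hx2b, e1, e2, e3, e4, e5, haZ, hab]
    have : k ≤ 1 := by
      by_contra! h
      have h' : (2:ℤ) ≤ k := by omega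
      have := mul_le_mul_of_nonneg_left h' hab.le
      nlinarith only [this, hk', hx2b, e1, e2, e3, e4, e5, haZ, hab]
    have hk1 : k ≠ 1 := by
      rintro rfl
      have hx0 : x^2 = 0 := by nlinarith only [hk', hx2b, e1, e2, e3, e4, e5, haZ, hab]
      have hx0 : x = 0 := by simpa using hx0
      have hz : (b:ℤ) * z^2 = b * a := by nlinarith only [hk', hx2b, e1, e2, e3, e4, e5, haZ, hab]
      have hz : z^2 = a := by
        exact mul_left_cancel₀ hB.ne' hz
      have hAz : A ∣ z := by
        rw [hx0] at hka'
        have h1 : A ∣ β * z := by simpa using hka'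
        have h2 : A ∣ b * z := by
          have : (b:ℤ) * z = β * (β * z) - (β^2 - b) * z := by ring
          rw [this]
          exact dvd_sub (h1.mul_left _) (hβ.mul_right _)
        exact hAB.dvd_of_dvd_mul_left h2
      obtain ⟨c, hc⟩ := hAz
      have h3 : (a:ℤ) * (a * c^2) = a * 1 := by
        rw [hc, hAa] at hz; linear_combination hz
      have h4 : (a:ℤ) * c^2 = 1 := mul_left_cancel₀ haZ.ne' h3
      have h5 : (a:ℤ) = 1 := by
        have : (a:ℤ) ∣ 1 := ⟨_, h4.symm⟩
        exact Int.eq_one_of_dvd_one haZ.le this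
      apply hA1; rw [hAa, h5]
    omega
  · have hAa : A = a := by omega
    have hk' : x^2 - a * y^2 - b * z^2 = (a * b * k) := by
      rw [hAa] at hk; linear_combination hk
    have : -(2:ℤ) < k := by
      by_contra! h
      have h' : (2:ℤ) ≤ -k := by omega
      have := mul_le_mul_of_nonneg_left h' hab.le
      nlinarith only [this, hk', hx2b, e1, e2, e3, e4, e5, haZ, hab]
    have : k ≤ 1 := by
      by_contra! h
      have h' : (2:ℤ) ≤ k := by omega
      have := mul_le_mul_of_nonneg_left h' hab.le
      nlinarith only [this, hk', hx2b, e1, e2, e3, e4, e5, haZ, hab]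
    have hk1 : k ≠ 1 := by
      rintro rfl
      have hx0 : x^2 = A * b := by rw [hAa]; nlinarith only [hk', hx2b, e1, e2, e3, e4, e5, haZ, hab]
      rcases Int.sq_of_isCoprime hAB hx0.symm with ⟨r, hr⟩
      rcases hr with hr | hr
      · exact hAs ⟨r, by rw [hr]; ring⟩
      · nlinarith only [sq_nonneg r, hr, hpos]
    omega


theorem coprime_trick (w M n : ℤ) (hn : n ≠ 0) :
    ∃ j : ℤ, 0 < j ∧ ∀ r : ℕ, r.Prime → (r:ℤ) ∣ n → ¬ (r:ℤ) ∣ M → ¬ (r:ℤ) ∣ w + M * j := by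
  classical
  let P := n.natAbs.primeFactors.filter (fun r : ℕ => ¬ (r:ℤ) ∣ w)
  have hP : ∀ p ∈ P, p.Prime := fun p hp => Nat.prime_of_mem_primeFactors (Finset.mem_filter.1 hp).1
  refine ⟨((∏ p ∈ P, p : ℕ) : ℤ), ?_, ?_⟩
  · have : 0 < ∏ p ∈ P, p := Finset.prod_pos (fun p hp => (hP p hp).pos)
    exact_mod_cast this
  · intro r hr hrn hrM h
    by_cases hw : (r:ℤ) ∣ w
    · have h1 : (r:ℤ) ∣ M * ((∏ p ∈ P, p : ℕ) : ℤ) := (dvd_add_right hw).1 h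
      rcases (Nat.prime_iff_prime_int.1 hr).dvd_or_dvd h1 with h2 | h2
      · exact hrM h2
      · have h3 : r ∣ ∏ p ∈ P, p := by exact_mod_cast h2
        obtain ⟨p, hp, hrp⟩ := (hr.prime.dvd_finsetProd_iff _).1 h3
        have : r = p := (Nat.prime_dvd_prime_iff_eq hr (hP p hp)).1 hrp
        subst this
        exact (Finset.mem_filter.1 hp).2 hw
    · have hmem : r ∈ P := by
        refine Finset.mem_filter.2 ⟨Nat.mem_primeFactors.2 ⟨hr, ?_, by simpa using hn⟩, hw⟩
        exact Int.natCast_dvd.1 hrn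
      have h3 : r ∣ ∏ p ∈ P, p := Finset.dvd_prod_of_mem (fun p => p) hmem
      have h4 : (r:ℤ) ∣ ((∏ p ∈ P, p : ℕ) : ℤ) := by exact_mod_cast h3
      exact hw ((dvd_add_left (h4.mul_left M)).1 h)

theorem isCoprime_of_primes (x y : ℤ)
    (h : ∀ r : ℕ, r.Prime → (r:ℤ) ∣ x → ¬ (r:ℤ) ∣ y) : IsCoprime x y := by
  rw [Int.isCoprime_iff_gcd_eq_one]
  by_contra hg
  obtain ⟨r, hr, hrg⟩ := Nat.exists_prime_and_dvd hg
  have hrg' : (r:ℤ) ∣ (Int.gcd x y : ℤ) := by exact_mod_cast hrg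
  exact h r hr (hrg'.trans (Int.gcd_dvd_left _ _)) (hrg'.trans (Int.gcd_dvd_right _ _))

theorem not_dvd_of_isCoprime {x y : ℤ} (h : IsCoprime x y) {r : ℕ} (hr : r.Prime)
    (h1 : (r:ℤ) ∣ x) : ¬ (r:ℤ) ∣ y := by
  intro h2
  have := h.isUnit_of_dvd' h1 h2
  exact (Nat.prime_iff_prime_int.1 hr).not_isUnit this

theorem sq_crt (m k D α β : ℤ) (h : IsCoprime m k) (hα : m ∣ α ^ 2 - D) (hβ : k ∣ β ^ 2 - D) :
    ∃ γ : ℤ, m * k ∣ γ ^ 2 - D := by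
  obtain ⟨u, v, huv⟩ := id h
  obtain ⟨s, hs⟩ := hα
  obtain ⟨t, ht⟩ := hβ
  refine ⟨α * (v * k) + β * (u * m), h.mul_dvd ?_ ?_⟩
  · refine ⟨s + (α * (v * k) + β * (u * m) + α) * ((β - α) * u), ?_⟩
    have : v * k = 1 - u * m := by linarith
    rw [this]; linear_combination hs
  · refine ⟨t + (α * (v * k) + β * (u * m) + β) * ((α - β) * v), ?_⟩
    have : u * m = 1 - v * k := by linarith
    rw [this]; linear_combination ht

theorem form_aux (D α : ℤ) (N q : ℕ) (hD0 : D ≠ 0) (hD1 : D ≠ -1) (hN : Odd N)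
    (hDN : IsCoprime D N) (hα : (N:ℤ) ∣ α ^ 2 - D) (hq : q.Prime) (hqN : N < q)
    (hqD : D.natAbs < q) (hmod : 8 * D ∣ q - N) :
    ∃ x y z : ℤ, (x ≠ 0 ∨ y ≠ 0 ∨ z ≠ 0) ∧ x ^ 2 = D * y ^ 2 + (q * N : ℤ) * z ^ 2 := by
  have hNpos : 0 < N := hN.pos
  have hqodd : Odd q := by
    have h2 : (2:ℤ) ∣ q - N := (Dvd.intro (4 * D) (by ring)).trans hmod
    obtain ⟨k, hk⟩ := hN
    rw [Nat.odd_iff]; omega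
  have hαN : IsCoprime α N := by
    obtain ⟨k, hk⟩ := hα
    have : IsCoprime (D + (N:ℤ) * k) N := hDN.add_mul_left_left k
    have h2 : IsCoprime (α ^ 2) (N:ℤ) := by
      have e : α ^ 2 = D + (N:ℤ) * k := by linarith
      rw [e]; exact this
    exact (IsCoprime.pow_left_iff (by norm_num)).1 h2
  have hJN : jacobiSym D N = 1 := by
    have h1 : jacobiSym (α ^ 2) N = jacobiSym D N := by
      apply jacobiSym.mod_left'
      exact Int.ModEq.symm ((Int.modEq_iff_dvd).2 hα)
    rw [← h1]
    exact jacobiSym.sq_one' (Int.isCoprime_iff_gcd_eq_one.1 hαN)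
  have hJq : jacobiSym D q = 1 := by
    rw [jacobiSym.mod_right D hqodd, ← hJN, jacobiSym.mod_right D hN]
    congr 1
    have : (4 * D.natAbs : ℤ) ∣ q - N := by
      refine Dvd.dvd.trans ?_ hmod
      rcases Int.natAbs_eq D with h | h
      · exact ⟨2, by conv_lhs => rw [h]
                     ring⟩
      · exact ⟨-2, by conv_lhs => rw [h]
                      ring⟩
    have h3 : (N : ℤ) ≡ q [ZMOD ((4 * D.natAbs : ℕ) : ℤ)] := (Int.modEq_iff_dvd).2 (by exact_mod_cast this)
    exact ((Int.natCast_modEq_iff).1 h3).symm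
  have : Fact q.Prime := ⟨hq⟩
  have hleg : legendreSym q D = 1 := by rw [jacobiSym.legendreSym.to_jacobiSym]; exact hJq
  have hDq : ((D:ℤ) : ZMod q) ≠ 0 := by
    intro h
    rw [ZMod.intCast_zmod_eq_zero_iff_dvd] at h
    have := Int.le_of_dvd (by omega) (Int.dvd_natAbs.2 h)
    omega
  obtain ⟨β, hβ⟩ := (legendreSym.eq_one_iff q hDq).1 hleg
  obtain ⟨β', rfl⟩ := ZMod.intCast_surjective β
  have hβ2 : (q:ℤ) ∣ β' ^ 2 - D := by
    rw [← ZMod.intCast_zmod_eq_zero_iff_dvd]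
    push_cast; rw [hβ]; ring
  have hqNc : IsCoprime (q:ℤ) (N:ℤ) := by
    rw [Nat.isCoprime_iff_coprime]
    exact (hq.coprime_iff_not_dvd).2 (Nat.not_dvd_of_pos_of_lt hNpos hqN)
  obtain ⟨γ, hγ⟩ := sq_crt q N D β' α hqNc hβ2 hα
  have hDqc : IsCoprime D q := by
    apply isCoprime_of_primes
    intro r hr h1 h2
    have : r = q := (Nat.prime_dvd_prime_iff_eq hr hq).1 (by exact_mod_cast h2)
    subst this
    exact hDq ((ZMod.intCast_zmod_eq_zero_iff_dvd _ _).2 h1)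
  refine legendre_aux D (q * N) (IsCoprime.mul_right hDqc hDN) (by have := hq.pos; positivity) hD0 hD1 γ N hγ ?_
  have : (N:ℤ) ^ 2 - q * N = - (q - N) * N := by ring
  rw [this]
  exact ((dvd_neg.2 ((Dvd.intro_left 8 rfl).trans hmod))).mul_right _

/-- Rational representation by the ternary form. -/
theorem ternary_rational (a b n y1 z1 w1 c N1 : ℤ) (j : ℕ) (ha : 0 < a) (hb : 0 < b)
    (hab : 1 < a * b) (hn : 0 < n)
    (hN : a * y1 ^ 2 + b * z1 ^ 2 = c * N1) (hc : 0 < c) (hcj : c ∣ (2 * a * b) ^ j)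
    (hN1 : 0 < N1) (hN1c : IsCoprime N1 (2 * a * b)) (hz : IsCoprime z1 N1)
    (h : 8 * a * b * c ∣ c * N1 + a * b * w1 ^ 2 - n) :
    ∃ y z w s : ℤ, s ≠ 0 ∧ a * y ^ 2 + b * z ^ 2 + a * b * w ^ 2 = n * s ^ 2 := by
  by_cases hsq : IsSquare (a * b * n)
  · obtain ⟨m, hm⟩ := hsq
    exact ⟨0, 0, m, a * b, by positivity, by linear_combination (-(a*b)) * hm⟩
  obtain ⟨k0, hk0⟩ := h
  obtain ⟨M, hM⟩ : ∃ M : ℤ, M = 8 * a * b * c := ⟨_, rfl⟩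
  have hMpos : 0 < M := by rw [hM]; positivity
  obtain ⟨j0, hj0, hj0p⟩ := coprime_trick |w1| M n hn.ne'
  obtain ⟨t, ht⟩ : ∃ t : ℤ, t = |w1| + M * j0 := ⟨_, rfl⟩
  rw [← ht] at hj0p
  have htpos : 0 < t := by rw [ht]; have := abs_nonneg w1; positivity
  obtain ⟨s, hs⟩ : ∃ s : ℤ, s = 1 + M * t * (a * b) := ⟨_, rfl⟩
  -- ρ
  obtain ⟨k1, hk1⟩ : ∃ k1 : ℤ, n * s ^ 2 - a * b * t ^ 2 = c * (N1 + 8 * a * b * k1) := by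
    refine ⟨- k0 + (n * (2 * (t * (a * b)) + M * (t * (a*b))^2)) - a * b * (2 * |w1| * j0 + M * j0 ^ 2), ?_⟩
    rw [hs, ht]
    have h2 : |w1| ^ 2 = w1 ^ 2 := sq_abs w1
    rw [← ht]
    have e1 : n * (1 + M * t * (a * b)) ^ 2 - a * b * t ^ 2
      = n - a * b * |w1|^2 + M * ((n * (2 * (t * (a * b)) + M * (t * (a*b))^2)) - a * b * (2 * |w1| * j0 + M * j0 ^ 2)) := by
      have : a * b * t ^ 2 = a * b * |w1|^2 + M * (a * b * (2 * |w1| * j0 + M * j0 ^ 2)) := by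
        rw [ht]; ring
      rw [this]; ring
    rw [e1, h2, hM]
    linear_combination - hk0
  obtain ⟨ρ, hρ⟩ : ∃ ρ : ℤ, ρ = N1 + 8 * a * b * k1 := ⟨_, rfl⟩
  rw [← hρ] at hk1
  have hρpos : 0 < ρ := by
    have h1 : a * b * t ^ 2 < n * s ^ 2 := by
      have e1 : a * b * t < s := by
        rw [hs]
        have : 1 * (t * (a * b)) ≤ M * (t * (a * b)) := by gcongr; omega
        nlinarith only [this]
      have e2 : a * b * t ^ 2 ≤ (a * b * t) ^ 2 := by
        have : (a * b * t) ^ 2 = (a * b) * (a * b * t ^ 2) := by ring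
        rw [this]
        have : 0 ≤ a * b * t ^ 2 := by positivity
        nlinarith only [this, hab]
      have e3 : (a * b * t) ^ 2 < s ^ 2 := by gcongr
      nlinarith only [e2, e3, hn, sq_nonneg s]
    have : 0 < c * ρ := by linarith
    exact pos_of_mul_pos_right this hc.le
  have hρab : IsCoprime ρ (2 * a * b) := by
    have : ρ = N1 + (2 * a * b) * (4 * k1) := by rw [hρ]; ring
    rw [this]; exact hN1c.add_mul_left_left _
  have hρM : ∀ r : ℕ, r.Prime → (r:ℤ) ∣ ρ → ¬ (r:ℤ) ∣ M := by
    intro r hr h1 h2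
    have hrp := Nat.prime_iff_prime_int.1 hr
    have h3 : ¬ (r:ℤ) ∣ 2 * a * b := not_dvd_of_isCoprime hρab hr h1
    rw [hM] at h2
    have h4 : (r:ℤ) ∣ (2 * a * b) * 4 * c := by
      have : (2 * a * b) * 4 * c = 8 * a * b * c := by ring
      rw [this]; exact h2
    rcases hrp.dvd_or_dvd h4 with h5 | h5
    · rcases hrp.dvd_or_dvd h5 with h6 | h6
      · exact h3 h6
      · have : (r:ℤ) ∣ 2 := by
          apply hrp.dvd_of_dvd_pow (n := 2)
          norm_num; exact h6
        exact h3 (by rw [mul_assoc]; exact this.mul_right _)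
    · exact h3 (hrp.dvd_of_dvd_pow (h5.trans hcj))
  have hρn : IsCoprime ρ n := by
    apply isCoprime_of_primes
    intro r hr h1 h2
    have hrp := Nat.prime_iff_prime_int.1 hr
    apply hj0p r hr h2 (hρM r hr h1)
    have h3 : ¬ (r:ℤ) ∣ 2 * a * b := not_dvd_of_isCoprime hρab hr h1
    have h4 : (r:ℤ) ∣ a * b * t ^ 2 := by
      have : a * b * t ^ 2 = n * s ^ 2 - c * ρ := by linarith
      rw [this]; exact dvd_sub (h2.mul_right _) (h1.mul_left _)
    rcases hrp.dvd_or_dvd h4 with h5 | h5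
    · exact absurd (by rw [mul_assoc]; exact h5.mul_left 2) h3
    · exact hrp.dvd_of_dvd_pow h5
  have htρ : IsCoprime t ρ := by
    apply isCoprime_of_primes
    intro r hr h1 h2
    have hrp := Nat.prime_iff_prime_int.1 hr
    have h4 : (r:ℤ) ∣ n * s ^ 2 := by
      have : n * s ^ 2 = a * b * t ^ 2 + c * ρ := by linarith
      rw [this]; exact dvd_add ((Dvd.dvd.pow h1 (by norm_num)).mul_left _) (h2.mul_left _)
    rcases hrp.dvd_or_dvd h4 with h5 | h5
    · exact not_dvd_of_isCoprime hρn hr h2 h5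
    · have h6 := hrp.dvd_of_dvd_pow h5
      have h7 : (r:ℤ) ∣ 1 := by
        have : (1:ℤ) = s - t * (M * (a * b)) := by rw [hs]; ring
        rw [this]; exact dvd_sub h6 (h1.mul_right _)
      exact hrp.not_isUnit (isUnit_of_dvd_one h7)
  -- the prime q
  obtain ⟨Q, hQ⟩ : ∃ Q : ℕ, (Q:ℤ) = 8 * (a * b * n) := ⟨(8 * (a * b * n)).toNat, by
    rw [Int.toNat_of_nonneg (by positivity)]⟩
  have hQ0 : Q ≠ 0 := by
    have : (0:ℤ) < Q := by rw [hQ]; positivity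
    omega
  have hρQ : IsCoprime ρ (Q:ℤ) := by
    rw [hQ]
    have h1 : IsCoprime ρ ((2 * a * b) ^ 3 * n) := IsCoprime.mul_right (hρab.pow_right) hρn
    refine IsCoprime.of_isCoprime_of_dvd_right h1 ?_
    exact ⟨(a * b) ^ 2, by ring⟩
  obtain ⟨q, hqgt, hqp, hqmod⟩ := Nat.forall_exists_prime_gt_and_zmodEq
    (N1.natAbs + ρ.natAbs + (a * b).natAbs + (a * b * n).natAbs) hQ0 hρQ
  have hqρ : (8 * (a * b * n)) ∣ (q:ℤ) - ρ := by
    rw [← hQ]; exact Int.modEq_iff_dvd.1 hqmod.symm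
  obtain ⟨N1', rfl⟩ : ∃ N' : ℕ, N1 = N' := ⟨N1.toNat, by omega⟩
  obtain ⟨ρ', rfl⟩ : ∃ N' : ℕ, ρ = N' := ⟨ρ.toNat, by omega⟩
  have oddof : ∀ N : ℕ, IsCoprime (N:ℤ) (2 * a * b) → Odd N := by
    intro N hNN
    rw [← Nat.not_even_iff_odd, even_iff_two_dvd]
    intro h2
    refine not_dvd_of_isCoprime hNN Nat.prime_two (by exact_mod_cast h2) ?_
    rw [mul_assoc]; exact dvd_mul_right _ _
  have cab : ∀ N : ℕ, IsCoprime (N:ℤ) (2 * a * b) → IsCoprime (N:ℤ) (a * b) := by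
    intro N hNN
    exact IsCoprime.of_isCoprime_of_dvd_right hNN ⟨2, by ring⟩
  -- first form
  obtain ⟨zi, hzi⟩ : ∃ zi : ℤ, (N1':ℤ) ∣ z1 * zi - 1 := by
    obtain ⟨u, v, huv⟩ := hz
    exact ⟨u, -v, by linear_combination huv⟩
  obtain ⟨x1, x2, x3, hx, hxe⟩ := form_aux (-(a * b)) (a * y1 * zi) N1' q (by
      have : 0 < a * b := by positivity
      omega) (by omega) (oddof _ hN1c) ((cab _ hN1c).symm.neg_left)
    (by
      obtain ⟨e, he⟩ := hzi
      have e1 : z1 * zi = 1 + N1' * e := by linarith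
      refine ⟨a * c * zi ^ 2 - a * b * (2 * e + N1' * e^2), ?_⟩
      have e2 : a * y1 ^ 2 = c * N1' - b * z1 ^ 2 := by linarith
      have : (a * y1 * zi) ^ 2 - -(a * b) = a * (a * y1 ^ 2) * zi ^ 2 + a * b := by ring
      rw [this, e2]
      have : a * (c * N1' - b * z1 ^ 2) * zi ^ 2 + a * b = a * c * N1' * zi ^ 2 - a * b * (z1 * zi) ^ 2 + a * b := by ring
      rw [this, e1]; ring) hqp (by omega) (by omega)
    (by
      have h1 : (8 * -(a * b)) ∣ (q:ℤ) - ρ' := Dvd.dvd.trans ⟨-n, by ring⟩ hqρ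
      have h2 : (8 * -(a * b)) ∣ (ρ':ℤ) - N1' := ⟨-k1, by rw [hρ]; ring⟩
      have := dvd_add h1 h2
      simpa using this)
  obtain ⟨ti, hti⟩ : ∃ zi : ℤ, (ρ':ℤ) ∣ t * zi - 1 := by
    obtain ⟨u, v, huv⟩ := htρ
    exact ⟨u, -v, by linear_combination huv⟩
  obtain ⟨v1, v2, v3, hv, hve⟩ := form_aux (a * b * n) (n * s * ti) ρ' q (by positivity)
    (by have : 0 < a * b * n := by positivity
        omega) (oddof _ hρab) ((cab _ hρab).mul_right hρn).symm
    (by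
      obtain ⟨e, he⟩ := hti
      have e1 : t * ti = 1 + ρ' * e := by linarith
      have e2 : n * s ^ 2 = c * ρ' + a * b * t ^ 2 := by linarith
      refine ⟨n * c * ti ^ 2 + a * b * n * (2 * e + ρ' * e^2), ?_⟩
      have : (n * s * ti) ^ 2 - (a * b * n) = n * (n * s ^ 2) * ti ^ 2 - a * b * n := by ring
      rw [this, e2]
      have : n * (c * ρ' + a * b * t ^ 2) * ti ^ 2 - a * b * n = n * c * ρ' * ti ^ 2 + a * b * n * (t * ti) ^ 2 - a * b * n := by ring
      rw [this, e1]; ring) hqp (by omega) (by omega) hqρ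
  have hx3 : x3 ≠ 0 := by
    rintro rfl
    have e1 : x1 ^ 2 + (a * b) * x2 ^ 2 = 0 := by linarith
    have hx1 : x1 = 0 := by
      have : x1 ^ 2 ≤ 0 := by have : 0 ≤ (a * b) * x2 ^ 2 := by positivity
                              linarith
      exact pow_eq_zero_iff (two_ne_zero) |>.1 (le_antisymm this (sq_nonneg _))
    have hx2 : x2 = 0 := by
      have e2 : a * b * x2 ^ 2 = 0 := by rw [hx1] at e1; linarith
      have e3 : a * b ≠ 0 := by positivity
      simpa [e3, ha.ne', hb.ne'] using e2
    simp [hx1, hx2] at hx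
  have hv3 : v3 ≠ 0 := by
    rintro rfl
    have e1 : v1 ^ 2 = (a * b * n) * v2 ^ 2 := by linarith
    by_cases hv2 : v2 = 0
    · rw [hv2] at e1
      have : v1 = 0 := by simpa using e1
      simp [this, hv2] at hv
    · have : v2 ^ 2 ∣ v1 ^ 2 := ⟨a * b * n, by rw [e1]; ring⟩
      obtain ⟨k, rfl⟩ := (Int.pow_dvd_pow_iff two_ne_zero).1 this
      apply hsq
      refine ⟨k, ?_⟩
      have : v2 ^ 2 * (k * k) = v2 ^ 2 * (a * b * n) := by linear_combination e1
      exact (mul_left_cancel₀ (pow_ne_zero 2 hv2) this).symm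
  have hq0 : (0:ℤ) < q := by exact_mod_cast hqp.pos
  have key1 : a * (y1 * x1 - b * z1 * x2) ^ 2 + b * (z1 * x1 + a * y1 * x2) ^ 2 = q * c * (N1' * x3) ^ 2 := by
    have : a * (y1 * x1 - b * z1 * x2) ^ 2 + b * (z1 * x1 + a * y1 * x2) ^ 2
      = (a * y1 ^ 2 + b * z1 ^ 2) * (x1 ^ 2 + a * b * x2 ^ 2) := by ring
    rw [this, hN, hxe]; ring
  have key2 : n * (s * v1 + a * b * t * v2) ^ 2 - a * b * (t * v1 + n * s * v2) ^ 2 = q * c * (ρ' * v3) ^ 2 := by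
    have : n * (s * v1 + a * b * t * v2) ^ 2 - a * b * (t * v1 + n * s * v2) ^ 2
      = (n * s ^ 2 - a * b * t ^ 2) * (v1 ^ 2 - a * b * n * v2 ^ 2) := by ring
    rw [this, hk1, hve]; ring
  refine ⟨(y1 * x1 - b * z1 * x2) * (ρ' * v3), (z1 * x1 + a * y1 * x2) * (ρ' * v3),
    (t * v1 + n * s * v2) * (N1' * x3), (s * v1 + a * b * t * v2) * (N1' * x3), ?_, ?_⟩
  · apply mul_ne_zero _ (mul_ne_zero hN1.ne' hx3)
    intro h0
    rw [h0] at key2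
    have e1 : 0 < q * c * (ρ' * v3) ^ 2 := by positivity
    have e2 : 0 ≤ a * b * (t * v1 + n * s * v2) ^ 2 := by positivity
    linarith
  · linear_combination (ρ' * v3) ^ 2 * key1 - (N1' * x3) ^ 2 * key2


theorem exists_pow_mul (p : ℕ) (hp : p.Prime) (n : ℤ) (hn : n ≠ 0) :
    ∃ (j : ℕ) (u : ℤ), n = (p:ℤ) ^ j * u ∧ ¬ (p:ℤ) ∣ u := by
  have hpp := Nat.prime_iff_prime_int.1 hp
  obtain ⟨u, hu, hgu⟩ := (FiniteMultiplicity.of_prime_left hpp hn).exists_eq_pow_mul_and_not_dvd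
  exact ⟨_, u, hu, hgu⟩

theorem hensel_sq (p : ℕ) (hp : p.Prime) (c t0 r : ℤ) (K g : ℕ)
    (hg : ¬ (p:ℤ) ^ (g + 1) ∣ 2 * c * t0) (h : (p:ℤ) ^ K ∣ c * t0 ^ 2 - r) (hK : 2 * g < K) (K' : ℕ) :
    ∃ t : ℤ, (p:ℤ) ^ K' ∣ c * t ^ 2 - r ∧ (p:ℤ) ^ (K - g) ∣ t - t0 := by
  have hpp := Nat.prime_iff_prime_int.1 hp
  have hne : 2 * c * t0 ≠ 0 := by intro h0; rw [h0] at hg; simp at hg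
  obtain ⟨g', u, hu, hgu⟩ := exists_pow_mul p hp _ hne
  have hgg : g' ≤ g := by
    by_contra! hlt
    apply hg
    rw [hu]
    exact (pow_dvd_pow _ hlt).mul_right _
  have main : ∀ j : ℕ, ∃ t : ℤ, (p:ℤ) ^ (K + j) ∣ c * t ^ 2 - r ∧ (p:ℤ) ^ (K - g') ∣ t - t0 := by
    intro j
    induction j with
    | zero => exact ⟨t0, by simpa using h, by simp⟩
    | succ j ih =>
      obtain ⟨t, ⟨e, he⟩, ⟨k, hk⟩⟩ := ih
      obtain ⟨l, hl⟩ : ∃ l, K = 2 * g' + 1 + l := ⟨K - (2 * g' + 1), by omega⟩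
      have e1 : K - g' = g' + 1 + l := by omega
      rw [e1] at hk
      obtain ⟨u', hu', hpu'⟩ : ∃ u' : ℤ, 2 * c * t = (p:ℤ) ^ g' * u' ∧ ¬ (p:ℤ) ∣ u' := by
        refine ⟨u + p * (2 * c * (p ^ l * k)), ?_, ?_⟩
        · have : t = t0 + (p:ℤ) ^ (g' + 1 + l) * k := by linarith
          rw [this]
          have : 2 * c * (t0 + (p:ℤ) ^ (g' + 1 + l) * k) = 2 * c * t0 + 2 * c * ((p:ℤ) ^ (g' + 1 + l) * k) := by ring
          rw [this, hu]; ring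
        · intro hd
          exact hgu ((dvd_add_left (dvd_mul_right _ _)).1 hd)
      have hcop : IsCoprime (p:ℤ) u' := (hpp.coprime_iff_not_dvd).2 hpu'
      obtain ⟨α, β, hαβ⟩ := hcop
      refine ⟨t + (p:ℤ) ^ (g' + 1 + l + j) * (-e * β), ?_, ?_⟩
      · refine ⟨e * α + c * (p:ℤ) ^ (l + j) * (-e * β) ^ 2, ?_⟩
        have e2 : c * (t + (p:ℤ) ^ (g' + 1 + l + j) * (-e * β)) ^ 2 - r
          = (c * t ^ 2 - r) + (2 * c * t) * ((p:ℤ) ^ (g' + 1 + l + j) * (-e * β)) + c * ((p:ℤ) ^ (g' + 1 + l + j) * (-e * β))^2 := by ring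
        rw [e2, he, hu', hl]
        have e3 : u' * β = 1 - α * p := by linarith
        have : (p:ℤ) ^ g' * u' * ((p:ℤ) ^ (g' + 1 + l + j) * (-e * β)) = (p:ℤ) ^ g' * ((p:ℤ) ^ (g' + 1 + l + j) * (-e * (u' * β))) := by ring
        rw [this, e3]
        ring
      · rw [e1]
        refine ⟨k + p ^ j * (-e * β), ?_⟩
        linear_combination hk
  obtain ⟨t, h1, h2⟩ := main K'
  exact ⟨t, (pow_dvd_pow _ (by omega)).trans h1, (pow_dvd_pow _ (by omega)).trans h2⟩

/-- Diagonal quadratic form. -/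
def qf {ι : Type} [Fintype ι] (c u : ι → ℤ) : ℤ := ∑ i, c i * u i ^ 2

/-- The associated bilinear form. -/
def bf {ι : Type} [Fintype ι] (c u v : ι → ℤ) : ℤ := ∑ i, c i * u i * v i

theorem qf_lin {ι : Type} [Fintype ι] (c u v : ι → ℤ) (s t : ℤ) :
    qf c (fun i => s * u i + t * v i) = s ^ 2 * qf c u + 2 * s * t * bf c u v + t ^ 2 * qf c v := by
  simp only [qf, bf, Finset.mul_sum, ← Finset.sum_add_distrib]
  exact Finset.sum_congr rfl (fun i _ => by ring)

theorem bf_lin {ι : Type} [Fintype ι] (c u v w : ι → ℤ) (s t : ℤ) :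
    bf c w (fun i => s * u i + t * v i) = s * bf c w u + t * bf c w v := by
  simp only [bf, Finset.mul_sum, ← Finset.sum_add_distrib]
  exact Finset.sum_congr rfl (fun i _ => by ring)

theorem qf_modEq {ι : Type} [Fintype ι] (c u v : ι → ℤ) (N : ℤ) (h : ∀ i, N ∣ u i - v i) :
    N ∣ qf c u - qf c v := by
  simp only [qf, ← Finset.sum_sub_distrib]
  refine Finset.dvd_sum (fun i _ => ?_)
  have : c i * u i ^ 2 - c i * v i ^ 2 = (u i - v i) * (c i * (u i + v i)) := by ring
  rw [this]; exact (h i).mul_right _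

theorem bf_modEq {ι : Type} [Fintype ι] (c w u v : ι → ℤ) (N : ℤ) (h : ∀ i, N ∣ u i - v i) :
    N ∣ bf c w u - bf c w v := by
  simp only [bf, ← Finset.sum_sub_distrib]
  refine Finset.dvd_sum (fun i _ => ?_)
  have : c i * w i * u i - c i * w i * v i = (u i - v i) * (c i * w i) := by ring
  rw [this]; exact (h i).mul_right _

theorem weak_approx {ι : Type} [Fintype ι] (c u : ι → ℤ) (d m : ℤ) (hu : qf c u = d * m ^ 2)
    (hm : m ≠ 0) (hd : d ≠ 0) (p : ℕ) (hp : p.Prime) (N : ℤ) (hNm : IsCoprime m N)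
    (hNp : IsCoprime (p:ℤ) N) (e0 : ι → ℤ) (he0 : IsCoprime (qf c e0) N) (J : ℕ) (y0 : ι → ℤ)
    (hy : ∀ K : ℕ, ∃ y : ι → ℤ, (p:ℤ) ^ K ∣ qf c y - d ∧ ∀ i, (p:ℤ) ^ J ∣ y i - y0 i) :
    ∃ (U : ι → ℤ) (m' : ℤ), qf c U = d * m' ^ 2 ∧ IsCoprime m' N ∧ ¬ (p:ℤ) ∣ m' ∧
      ∀ i, (p:ℤ) ^ J ∣ U i - m' * y0 i := by
  have hpp := Nat.prime_iff_prime_int.1 hp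
  have hp0 : (p:ℤ) ≠ 0 := hpp.ne_zero
  have h4 : 4 * d * m ^ 2 ≠ 0 := by positivity
  obtain ⟨j1, u1, hu1, hpu1⟩ := exists_pow_mul p hp _ h4
  obtain ⟨j0, hj0⟩ : ∃ j0, j0 = j1 + 1 := ⟨_, rfl⟩
  have h4n : ¬ (p:ℤ) ^ j0 ∣ 4 * d * m ^ 2 := by
    rw [hu1, hj0, pow_succ]
    intro h
    exact hpu1 ((mul_dvd_mul_iff_left (pow_ne_zero _ hp0)).1 h)
  obtain ⟨yK, hyK1, hyK2⟩ := hy (j0 + J)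
  -- sign
  obtain ⟨ε, hε, hεn⟩ : ∃ ε : ℤ, ε ^ 2 = 1 ∧ ¬ (p:ℤ) ^ j0 ∣ 2 * d * m ^ 2 - 2 * m * (ε * bf c u yK) := by
    by_contra! hcon
    apply h4n
    have h1 := hcon 1 (by norm_num)
    have h2 := hcon (-1) (by norm_num)
    have := dvd_add h1 h2
    have e : 2 * d * m ^ 2 - 2 * m * (1 * bf c u yK) + (2 * d * m ^ 2 - 2 * m * (-1 * bf c u yK)) = 4 * d * m ^ 2 := by ring
    rwa [e] at this
  obtain ⟨iv, w, hiv⟩ : IsCoprime (m * (p:ℤ) ^ (j0 + J)) N := hNm.mul_left hNp.pow_left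
  obtain ⟨y, hydef⟩ : ∃ y : ι → ℤ, y = fun i => ε * yK i + (p:ℤ) ^ (j0 + J) * (iv * (u i - e0 i - m * ε * yK i)) := ⟨_, rfl⟩
  have hyp : ∀ i, (p:ℤ) ^ (j0 + J) ∣ y i - ε * yK i := by
    intro i; rw [hydef]; exact ⟨_, add_sub_cancel_left _ _⟩
  obtain ⟨x, hxdef⟩ : ∃ x : ι → ℤ, x = fun i => 1 * u i + (-m) * y i := ⟨_, rfl⟩
  have hxN : ∀ i, N ∣ x i - e0 i := by
    intro i
    refine ⟨w * (u i - e0 i - m * ε * yK i), ?_⟩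
    rw [hxdef, hydef]
    simp only
    linear_combination (-(u i - e0 i - m * ε * yK i)) * hiv
  have hεK : qf c (fun i => ε * yK i) = qf c yK := by
    have := qf_lin c yK 0 ε 0
    simp only [zero_mul, add_zero] at this
    rw [this, hε]; ring
  have hδ : (p:ℤ) ^ (j0 + J) ∣ qf c y - d := by
    have h1 := qf_modEq c y (fun i => ε * yK i) _ hyp
    rw [hεK] at h1
    have := dvd_add h1 hyK1
    simpa using this
  obtain ⟨δ, hδe⟩ := hδ
  have hF : qf c x = 2 * d * m ^ 2 - 2 * m * bf c u y + m ^ 2 * ((p:ℤ) ^ (j0 + J) * δ) := by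
    rw [hxdef, qf_lin, hu, ← hδe]; ring
  have hFn : ¬ (p:ℤ) ^ j0 ∣ qf c x := by
    intro hdiv
    apply hεn
    have h1 := bf_modEq c u y (fun i => ε * yK i) _ hyp
    have h2 : bf c u (fun i => ε * yK i) = ε * bf c u yK := by
      have := bf_lin c yK 0 u ε 0
      simpa using this
    rw [h2] at h1
    have hle : (p:ℤ) ^ j0 ∣ (p:ℤ) ^ (j0 + J) := pow_dvd_pow _ (by omega)
    have e : 2 * d * m ^ 2 - 2 * m * (ε * bf c u yK) = qf c x + 2 * m * (bf c u y - ε * bf c u yK) - (p:ℤ) ^ (j0 + J) * (m ^ 2 * δ) := by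
      rw [hF]; ring
    rw [e]
    exact dvd_sub (dvd_add hdiv ((hle.trans h1).mul_left _)) (hle.mul_right _)
  have hF0 : qf c x ≠ 0 := by intro h; rw [h] at hFn; simp at hFn
  obtain ⟨j, F', hF', hpF'⟩ := exists_pow_mul p hp _ hF0
  have hj : j < j0 := by
    by_contra! hle
    apply hFn
    rw [hF']; exact (pow_dvd_pow _ hle).mul_right _
  obtain ⟨l, hl⟩ : ∃ l, j0 = j + l := ⟨j0 - j, by omega⟩
  -- U = (F y + m δ x) / p^j
  refine ⟨fun i => F' * y i + (m * ((p:ℤ) ^ (l + J) * δ)) * x i, ε * F', ?_, ?_, ?_, ?_⟩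
  · have hb : bf c y x = bf c u y - m * qf c y := by
      have := bf_lin c u y y 1 (-m)
      rw [hxdef, this]
      have e1 : bf c y u = bf c u y := by
        simp only [bf]; exact Finset.sum_congr rfl (fun i _ => by ring)
      have e2 : bf c y y = qf c y := by
        simp only [bf, qf]; exact Finset.sum_congr rfl (fun i _ => by ring)
      rw [e1, e2]; ring
    rw [qf_lin, hb]
    have hqy : qf c y = d + (p:ℤ) ^ (j0 + J) * δ := by linarith
    have hpj : (p:ℤ) ^ (j0 + J) = (p:ℤ) ^ j * (p:ℤ) ^ (l + J) := by rw [hl]; ring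
    have hF2 := hF
    rw [hF', hpj] at hF2
    rw [hF', hqy, hpj]
    have : (ε * F') ^ 2 = F' ^ 2 := by rw [mul_pow, hε]; ring
    rw [this]
    linear_combination (F' * (p:ℤ) ^ (l + J) * δ) * hF2
  · have h1 : IsCoprime (qf c x) N := by
      obtain ⟨k, hk⟩ := qf_modEq c x e0 N hxN
      have : qf c x = qf c e0 + N * k := by linarith
      rw [this]; exact he0.add_mul_left_left k
    rw [hF'] at h1
    have h2 := h1.of_mul_left_right
    have h3 : IsCoprime ε N := by
      have : IsCoprime (ε ^ 2) N := by rw [hε]; exact isCoprime_one_left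
      exact (IsCoprime.pow_left_iff (by norm_num)).1 this
    exact h3.mul_left h2
  · intro h
    apply hpF'
    have : F' = ε * (ε * F') := by linear_combination (-F') * hε
    rw [this]; exact h.mul_left _
  · intro i
    obtain ⟨k1, hk1⟩ := hyp i
    obtain ⟨k2, hk2⟩ := hyK2 i
    refine ⟨F' * (p ^ j0 * k1) + F' * ε * k2 + m * (p ^ l * δ) * x i, ?_⟩
    have : y i = ε * (y0 i + (p:ℤ) ^ J * k2) + (p:ℤ) ^ (j0 + J) * k1 := by rw [← hk2]; linarith
    simp only
    rw [this]; ring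


theorem fin3_sum (F : Fin 3 → ℤ) (i : Fin 3) : ∑ k, F k = F i + F (i + 1) + F (i + 2) := by
  fin_cases i
  · simp [Fin.sum_univ_three]
  · have e1 : (1 : Fin 3) + 1 = 2 := rfl
    have e2 : (1 : Fin 3) + 2 = 0 := rfl
    simp [Fin.sum_univ_three, e1, e2]; ring
  · have e1 : (2 : Fin 3) + 1 = 0 := rfl
    have e2 : (2 : Fin 3) + 2 = 1 := rfl
    simp [Fin.sum_univ_three, e1, e2]; ring

theorem fin3_cases (i k : Fin 3) : k = i ∨ k = i + 1 ∨ k = i + 2 := by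
  revert i k; decide

theorem floor_close (m s A B : ℤ) (hs : 0 < s) (h : m * A / s = m * B / s) : |m * (A - B)| < s := by
  have h1 := Int.emod_add_mul_ediv (m * A) s
  have h2 := Int.emod_add_mul_ediv (m * B) s
  have h3 := Int.emod_nonneg (m * A) hs.ne'
  have h4 := Int.emod_nonneg (m * B) hs.ne'
  have h5 := Int.emod_lt_of_pos (m * A) hs
  have h6 := Int.emod_lt_of_pos (m * B) hs
  rw [h] at h1
  rw [abs_lt, mul_sub]
  constructor <;> linarith

set_option maxHeartbeats 800000 in
theorem short_vec (c : Fin 3 → ℤ) (hc : ∀ i, 0 < c i) : ∃ R : ℤ, 0 < R ∧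
    ∀ (s : ℤ) (u h : Fin 3 → ℤ), 0 < s → (∀ l : ℤ, (∀ i, s ∣ l * u i) → s ∣ l) →
      s ^ 2 ∣ qf c u → h ≠ 0 → ∃ (C : Fin 3 → ℤ) (l : ℤ), s ∣ bf c u C ∧
        (∀ i, |s * C i + l * u i| < R * s) ∧ ∑ i, h i * (s * C i + l * u i) ≠ 0 := by
  obtain ⟨m, hm⟩ : ∃ m : ℤ, m = 4 * (∑ i, c i) + 1 := ⟨_, rfl⟩
  have hsum : 0 < ∑ i, c i := Finset.sum_pos (fun i _ => hc i) ⟨0, Finset.mem_univ _⟩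
  have hm0 : 0 < m := by omega
  have hm2 : 4 * (∑ i, c i) < m ^ 2 := by nlinarith
  obtain ⟨R, hR⟩ : ∃ R : ℤ, R = m ^ 2 + 1 := ⟨_, rfl⟩
  have hR0 : 0 < R := by rw [hR]; positivity
  refine ⟨R, hR0, ?_⟩
  intro s u h hs hprim hu hh
  obtain ⟨i0, hi0⟩ := Finite.exists_max (fun i => |h i|)
  have hh0 : 0 < |h i0| := by
    by_contra! hle
    apply hh
    funext i
    have := (hi0 i).trans hle
    simpa using this
  let Cf : (Fin 3 → ℤ) × ℤ → Fin 3 → ℤ := fun P i => P.1 i - (P.2 * u i) / s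
  let Y : (Fin 3 → ℤ) × ℤ → Fin 3 → ℤ := fun P i => s * Cf P i + P.2 * u i
  have hY : ∀ P i, Y P i = s * P.1 i + (P.2 * u i) % s := by
    intro P i
    have := Int.emod_add_mul_ediv (P.2 * u i) s
    simp only [Y, Cf]; linarith
  let src : Finset ((Fin 3 → ℤ) × ℤ) := (Fintype.piFinset (fun _ => Finset.Ico 0 R)) ×ˢ Finset.Ico 0 s
  let tgt : Finset (ℤ × ℤ × ℤ) := Finset.Ico 0 (m * R) ×ˢ Finset.Ico 0 (m * R) ×ˢ Finset.Ico 0 s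
  let key : (Fin 3 → ℤ) × ℤ → ℤ × ℤ × ℤ := fun P =>
    (m * Y P (i0 + 1) / s, m * Y P (i0 + 2) / s, bf c u (Cf P) % s)
  have hYb : ∀ P ∈ src, ∀ i, 0 ≤ Y P i ∧ Y P i < R * s := by
    intro P hP i
    simp only [src, Finset.mem_product, Fintype.mem_piFinset, Finset.mem_Ico] at hP
    obtain ⟨hP1, hP2⟩ := hP
    rw [hY]
    have h3 := Int.emod_nonneg (P.2 * u i) hs.ne'
    have h5 := Int.emod_lt_of_pos (P.2 * u i) hs
    have h6 := hP1 i
    constructor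
    · have := mul_nonneg hs.le h6.1
      linarith
    · have : s * (P.1 i + 1) ≤ s * R := by apply mul_le_mul_of_nonneg_left _ hs.le; omega
      nlinarith
  have hmaps : Set.MapsTo key src tgt := by
    intro P hP
    have hP' := hYb P hP
    have aux : ∀ i, 0 ≤ m * Y P i / s ∧ m * Y P i / s < m * R := by
      intro i
      obtain ⟨h1, h2⟩ := hP' i
      refine ⟨Int.ediv_nonneg (by positivity) hs.le, Int.ediv_lt_of_lt_mul hs ?_⟩
      rw [mul_assoc]
      exact mul_lt_mul_of_pos_left h2 hm0
    simp only [key, tgt, Finset.coe_product, Set.mem_prod, Finset.coe_Ico, Set.mem_Ico]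
    exact ⟨aux _, aux _, Int.emod_nonneg _ hs.ne', Int.emod_lt_of_pos _ hs⟩
  have hcard : tgt.card < src.card := by
    have e1 : (tgt.card : ℤ) = (m * R) * ((m * R) * s) := by
      simp only [tgt, Finset.card_product, Int.card_Ico, sub_zero]
      push_cast
      rw [Int.toNat_of_nonneg (by positivity), Int.toNat_of_nonneg hs.le]
    have e2 : (src.card : ℤ) = R ^ 3 * s := by
      simp only [src, Finset.card_product, Int.card_Ico, sub_zero, Fintype.card_piFinset, Finset.prod_const, Finset.card_univ, Fintype.card_fin]
      push_cast
      rw [Int.toNat_of_nonneg hR0.le, Int.toNat_of_nonneg hs.le]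
    zify
    rw [e1, e2]
    have : 0 < R ^ 2 * s := by positivity
    have e3 : R ^ 3 * s = (m ^ 2 + 1) * (R ^ 2 * s) := by rw [← hR]; ring
    rw [e3]; nlinarith
  obtain ⟨P, hP, Q, hQ, hPQ, hkey⟩ := Finset.exists_ne_map_eq_of_card_lt_of_maps_to hcard hmaps
  simp only [key, Prod.mk.injEq] at hkey
  obtain ⟨hk1, hk2, hk3⟩ := hkey
  have hk1' := floor_close m s _ _ hs hk1
  have hk2' := floor_close m s _ _ hs hk2
  obtain ⟨D, hD⟩ : ∃ D : Fin 3 → ℤ, D = fun i => Y P i - Y Q i := ⟨_, rfl⟩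
  have hDC : ∀ i, s * (1 * Cf P i + (-1) * Cf Q i) + (P.2 - Q.2) * u i = D i := by
    intro i; rw [hD]; simp only [Y]; ring
  have hbf : s ∣ bf c u (fun i => 1 * Cf P i + (-1) * Cf Q i) := by
    rw [bf_lin]
    have := Int.ModEq.dvd (show bf c u (Cf Q) ≡ bf c u (Cf P) [ZMOD s] from hk3.symm)
    have e : 1 * bf c u (Cf P) + -1 * bf c u (Cf Q) = bf c u (Cf P) - bf c u (Cf Q) := by ring
    rw [e]; exact this
  refine ⟨fun i => 1 * Cf P i + (-1) * Cf Q i, P.2 - Q.2, hbf, ?_, ?_⟩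
  · intro i
    rw [hDC, hD]
    have h1 := hYb P hP i
    have h2 := hYb Q hQ i
    rw [abs_lt]; constructor <;> linarith
  · simp only [hDC]
    intro hz
    rw [fin3_sum _ i0] at hz
    have hk1D : |m * D (i0 + 1)| < s := by rw [hD]; exact hk1'
    have hk2D : |m * D (i0 + 2)| < s := by rw [hD]; exact hk2'
    have hk0D : |m * D i0| < 2 * s := by
      have e1 : |h i0| * |m * D i0| = |h (i0 + 1) * (m * D (i0 + 1)) + h (i0 + 2) * (m * D (i0 + 2))| := by
        rw [← abs_mul, ← abs_neg]
        congr 1; linear_combination (-m) * hz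
      have e2 : |h i0| * |m * D i0| < |h i0| * (2 * s) := by
        rw [e1]
        calc _ ≤ |h (i0 + 1) * (m * D (i0 + 1))| + |h (i0 + 2) * (m * D (i0 + 2))| := abs_add_le _ _
          _ = |h (i0 + 1)| * |(m * D (i0 + 1))| + |h (i0 + 2)| * |(m * D (i0 + 2))| := by rw [abs_mul (h (i0 + 1)), abs_mul (h (i0 + 2))]
          _ ≤ |h i0| * |(m * D (i0 + 1))| + |h i0| * |(m * D (i0 + 2))| := by
              have := hi0 (i0 + 1)
              have := hi0 (i0 + 2)
              gcongr
          _ < |h i0| * (2 * s) := by nlinarith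
      exact lt_of_mul_lt_mul_left e2 hh0.le
    have hall : ∀ i, |m * D i| < 2 * s := by
      intro i
      rcases fin3_cases i0 i with rfl | rfl | rfl
      · exact hk0D
      · linarith
      · linarith
    have hsq : ∀ i, m ^ 2 * D i ^ 2 ≤ 4 * s ^ 2 := by
      intro i
      have h1 := hall i
      have h2 : |m * D i| ^ 2 ≤ (2 * s) ^ 2 := by gcongr
      rw [sq_abs] at h2
      linarith
    have hqD : m ^ 2 * qf c D ≤ 4 * (∑ i, c i) * s ^ 2 := by
      simp only [qf, Finset.mul_sum, Finset.sum_mul]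
      apply Finset.sum_le_sum
      intro i _
      have := mul_le_mul_of_nonneg_left (hsq i) (hc i).le
      linarith
    have hs2 : s ^ 2 ∣ qf c D := by
      have : D = fun i => s * (1 * Cf P i + (-1) * Cf Q i) + (P.2 - Q.2) * u i := by
        funext i; exact (hDC i).symm
      rw [this, qf_lin c (fun i => 1 * Cf P i + (-1) * Cf Q i) u s (P.2 - Q.2)]
      have e : bf c (fun i => 1 * Cf P i + (-1) * Cf Q i) u = bf c u (fun i => 1 * Cf P i + (-1) * Cf Q i) := by
        simp only [bf]; exact Finset.sum_congr rfl (fun i _ => by ring)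
      rw [e]
      obtain ⟨k, hk⟩ := hbf
      rw [hk]
      refine dvd_add (dvd_add (dvd_mul_right _ _) ⟨2 * (P.2 - Q.2) * k, by ring⟩) (hu.mul_left _)
    have hq0 : qf c D = 0 := by
      have hnn : 0 ≤ qf c D := Finset.sum_nonneg (fun i _ => mul_nonneg (hc i).le (sq_nonneg _))
      obtain ⟨k, hk⟩ := hs2
      have hs2p : 0 < s ^ 2 := by positivity
      have hk1 : k < 1 := by
        by_contra! hge
        have : s ^ 2 * 1 ≤ qf c D := by rw [hk]; gcongr
        have : m ^ 2 * (s ^ 2) ≤ m ^ 2 * qf c D := by rw [mul_one] at this; gcongr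
        nlinarith
      have hk0 : 0 ≤ k := by
        by_contra! hlt
        nlinarith
      have : k = 0 := by omega
      rw [hk, this, mul_zero]
    have hD0 : ∀ i, D i = 0 := by
      intro i
      have := (Finset.sum_eq_zero_iff_of_nonneg (fun i _ => mul_nonneg (hc i).le (sq_nonneg (D i)))).1 hq0 i (Finset.mem_univ _)
      rcases mul_eq_zero.1 this with h1 | h1
      · exact absurd h1 (hc i).ne'
      · simpa using h1
    -- contradiction
    have hYe : ∀ i, s * P.1 i + (P.2 * u i) % s = s * Q.1 i + (Q.2 * u i) % s := by
      intro i
      have := hD0 i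
      rw [hD] at this
      simp only [hY] at this
      linarith
    have hmodq : ∀ i, (P.2 * u i) % s = (Q.2 * u i) % s := by
      intro i
      have h1 := congrArg (· % s) (hYe i)
      simpa using h1
    apply hPQ
    have hl : P.2 = Q.2 := by
      have h1 : s ∣ P.2 - Q.2 := by
        apply hprim
        intro i
        have := Int.ModEq.dvd (show (Q.2 * u i) ≡ P.2 * u i [ZMOD s] from (hmodq i).symm)
        rw [sub_mul]; exact this
      simp only [src, Finset.mem_product, Finset.mem_Ico] at hP hQ
      obtain ⟨k, hk⟩ := h1
      have hk1 : k < 1 := by nlinarith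
      have hk2 : -1 < k := by nlinarith
      have : k = 0 := by omega
      rw [this] at hk; linarith
    apply Prod.ext _ hl
    funext i
    have h1 := hYe i
    rw [hmodq i] at h1
    have : s * P.1 i = s * Q.1 i := by linarith
    exact mul_left_cancel₀ hs.ne' this


theorem bf_comm' {ι : Type} [Fintype ι] (c u v : ι → ℤ) : bf c u v = bf c v u := by
  simp only [bf]; exact Finset.sum_congr rfl (fun i _ => by ring)

theorem bf_self {ι : Type} [Fintype ι] (c u : ι → ℤ) : bf c u u = qf c u := by
  simp only [bf, qf]; exact Finset.sum_congr rfl (fun i _ => by ring)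

theorem qf_comb (c ζ : Fin 3 → ℤ) (Y : Fin 3 → Fin 3 → ℤ) :
    qf c (fun i => ∑ k, ζ k * Y k i) = ∑ k, ∑ l, ζ k * ζ l * bf c (Y k) (Y l) := by
  simp only [qf, bf, Fin.sum_univ_three]; ring

theorem bf_comb (c ζ v : Fin 3 → ℤ) (Y : Fin 3 → Fin 3 → ℤ) :
    bf c v (fun i => ∑ k, ζ k * Y k i) = ∑ k, ζ k * bf c v (Y k) := by
  simp only [bf, Fin.sum_univ_three]; ring

/-- Three independent vectors with given Gram matrix (up to scale) and given residues. -/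
def TypeData (c : Fin 3 → ℤ) (p L : ℕ) (G ρ : Fin 3 → Fin 3 → ℤ) (s : ℤ) (Y : Fin 3 → Fin 3 → ℤ) : Prop :=
  0 < s ∧ ¬ (p:ℤ) ∣ s ∧ (∀ k l, bf c (Y k) (Y l) = s ^ 2 * G k l) ∧
    (∀ k i, (p:ℤ) ^ L ∣ Y k i - s * ρ k i) ∧ (Matrix.of Y).det ≠ 0

theorem TypeData.det_ne {c : Fin 3 → ℤ} (hc : ∀ i, 0 < c i) {p L : ℕ} {G ρ : Fin 3 → Fin 3 → ℤ} {s : ℤ}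
    {Y : Fin 3 → Fin 3 → ℤ} (h : TypeData c p L G ρ s Y) : (Matrix.of G).det ≠ 0 := by
  obtain ⟨hs, -, hG, -, hdet⟩ := h
  have e : (s ^ 2) • Matrix.of G = Matrix.of Y * Matrix.diagonal c * (Matrix.of Y).transpose := by
    ext k l
    have := hG k l
    simp only [bf, Fin.sum_univ_three] at this
    rw [Matrix.mul_apply]
    simp only [Matrix.smul_apply, Matrix.of_apply, smul_eq_mul, Matrix.mul_diagonal,
      Matrix.transpose_apply, Fin.sum_univ_three]
    linarith
  have e2 := congrArg Matrix.det e
  rw [Matrix.det_smul, Matrix.det_mul, Matrix.det_mul, Matrix.det_diagonal, Matrix.det_transpose] at e2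
  intro h0
  rw [h0, mul_zero] at e2
  have hp : ∏ i, c i ≠ 0 := Finset.prod_ne_zero_iff.2 (fun i _ => (hc i).ne')
  exact mul_ne_zero (mul_ne_zero hdet hp) hdet e2.symm

theorem transfer (c : Fin 3 → ℤ) (hc : ∀ i, 0 < c i) (p : ℕ) (hp : p.Prime) (L J j : ℕ) (G ρ : Fin 3 → Fin 3 → ℤ)
    (s s' : ℤ) (Y Y' : Fin 3 → Fin 3 → ℤ) (h : TypeData c p L G ρ s Y) (h' : TypeData c p L G ρ s' Y')
    (Δ' : ℤ) (hΔ : (Matrix.of G).det = (p:ℤ) ^ j * Δ') (hj : j + J ≤ L)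
    (u β : Fin 3 → ℤ) (n : ℤ) (hu : qf c u = n * s ^ 2) (hβ : ∀ k, bf c (Y k) u = s ^ 2 * β k) :
    ∃ V : Fin 3 → ℤ, qf c V = (s' * Δ') ^ 2 * n ∧ ∀ i, (p:ℤ) ^ J ∣ s * V i - (s' * Δ') * u i := by
  have hpp := Nat.prime_iff_prime_int.1 hp
  have hp0 : (p:ℤ) ≠ 0 := hpp.ne_zero
  obtain ⟨hs, hps, hG, hρ, hdet⟩ := id h
  obtain ⟨hs', hps', hG', hρ', hdet'⟩ := id h'
  obtain ⟨Δ, hΔd⟩ : ∃ Δ, Δ = (Matrix.of G).det := ⟨_, rfl⟩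
  have hΔ0 : Δ ≠ 0 := by rw [hΔd]; exact h.det_ne hc
  obtain ⟨ζ, hζ⟩ : ∃ ζ : Fin 3 → ℤ, ζ = Matrix.mulVec (Matrix.adjugate (Matrix.of G)) β := ⟨_, rfl⟩
  have hGζ : ∀ l, ∑ k, G l k * ζ k = Δ * β l := by
    intro l
    have : Matrix.mulVec (Matrix.of G) ζ = Δ • β := by
      rw [hζ, Matrix.mulVec_mulVec, Matrix.mul_adjugate, ← hΔd, Matrix.smul_mulVec, Matrix.one_mulVec]
    have h2 := congrFun this l
    simpa [Matrix.mulVec, dotProduct] using h2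
  have hYζ : ∀ i, ∑ k, ζ k * Y k i = Δ * u i := by
    have hx : Matrix.mulVec (Matrix.of Y) (fun i => c i * (1 * (∑ k, ζ k * Y k i) + (-Δ) * u i)) = 0 := by
      funext l
      have h1 : bf c (Y l) (fun i => 1 * (∑ k, ζ k * Y k i) + (-Δ) * u i) = 0 := by
        rw [bf_lin, bf_comb, hβ]
        simp only [hG]
        have := hGζ l
        simp only [Fin.sum_univ_three] at this ⊢
        linear_combination s ^ 2 * this
      simp only [Matrix.mulVec, dotProduct, Matrix.of_apply, Pi.zero_apply]
      rw [← h1]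
      simp only [bf]
      exact Finset.sum_congr rfl (fun i _ => by ring)
    have h0 := Matrix.eq_zero_of_mulVec_eq_zero hdet hx
    intro i
    have h1 := congrFun h0 i
    simp only [Pi.zero_apply] at h1
    rcases mul_eq_zero.1 h1 with h2 | h2
    · exact absurd h2 (hc i).ne'
    · linarith
  have hζG : ∑ k, ∑ l, ζ k * ζ l * G k l = Δ ^ 2 * n := by
    have h1 := qf_comb c ζ Y
    have h2 : (fun i => ∑ k, ζ k * Y k i) = fun i => Δ * u i + 0 * u i := by
      funext i; rw [hYζ i]; ring
    rw [h2, qf_lin, hu] at h1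
    simp only [hG] at h1
    have h3 : s ^ 2 * (∑ k, ∑ l, ζ k * ζ l * G k l) = s ^ 2 * (Δ ^ 2 * n) := by
      simp only [Fin.sum_univ_three] at h1 ⊢
      linear_combination - h1
    exact mul_left_cancel₀ (by positivity) h3
  have hcong : ∀ i, (p:ℤ) ^ L ∣ s * (∑ k, ζ k * Y' k i) - s' * Δ * u i := by
    intro i
    have : s * (∑ k, ζ k * Y' k i) - s' * Δ * u i = ∑ k, ζ k * (s * (Y' k i - s' * ρ k i) - s' * (Y k i - s * ρ k i)) := by
      rw [mul_assoc, ← hYζ i]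
      simp only [Fin.sum_univ_three]; ring
    rw [this]
    exact Finset.dvd_sum (fun k _ => (dvd_sub ((hρ' k i).mul_left _) ((hρ k i).mul_left _)).mul_left _)
  have hdiv : ∀ i, ∃ v : ℤ, ∑ k, ζ k * Y' k i = (p:ℤ) ^ j * v := by
    intro i
    have h1 : (p:ℤ) ^ j ∣ s * (∑ k, ζ k * Y' k i) := by
      have h2 : (p:ℤ) ^ j ∣ s * (∑ k, ζ k * Y' k i) - s' * Δ * u i := (pow_dvd_pow _ (by omega)).trans (hcong i)
      have h3 : (p:ℤ) ^ j ∣ s' * Δ * u i := by rw [hΔd, hΔ]; exact ⟨s' * Δ' * u i, by ring⟩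
      exact (dvd_sub_left h3).1 h2
    have hcp : IsCoprime ((p:ℤ) ^ j) s := IsCoprime.pow_left ((hpp.coprime_iff_not_dvd).2 hps)
    exact hcp.dvd_of_dvd_mul_left h1
  choose V hV using hdiv
  refine ⟨V, ?_, ?_⟩
  · have h1 := qf_comb c ζ Y'
    have h2 : (fun i => ∑ k, ζ k * Y' k i) = fun i => (p:ℤ) ^ j * V i + 0 * V i := by
      funext i; rw [hV i]; ring
    rw [h2, qf_lin] at h1
    simp only [hG'] at h1
    have h3 : (p:ℤ) ^ (2 * j) * qf c V = (p:ℤ) ^ (2 * j) * ((s' * Δ') ^ 2 * n) := by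
      have h4 : ∑ k, ∑ l, ζ k * ζ l * (s' ^ 2 * G k l) = s' ^ 2 * (Δ ^ 2 * n) := by
        rw [← hζG]; simp only [Fin.sum_univ_three]; ring
      rw [h4, hΔd, hΔ] at h1
      linear_combination h1
    exact mul_left_cancel₀ (pow_ne_zero _ hp0) h3
  · intro i
    have h1 := hcong i
    rw [hV i, hΔd, hΔ] at h1
    have h2 : s * ((p:ℤ) ^ j * V i) - s' * ((p:ℤ) ^ j * Δ') * u i = (p:ℤ) ^ j * (s * V i - s' * Δ' * u i) := by ring
    rw [h2] at h1
    have h3 : (p:ℤ) ^ j * (p:ℤ) ^ J ∣ (p:ℤ) ^ j * (s * V i - s' * Δ' * u i) := by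
      rw [← pow_add]; exact (pow_dvd_pow _ hj).trans h1
    exact (mul_dvd_mul_iff_left (pow_ne_zero _ hp0)).1 h3

/-- Existence of a bounded basis. -/
theorem exists_basis (c : Fin 3 → ℤ) (hc : ∀ i, 0 < c i) : ∃ B : ℤ, 0 < B ∧
    ∀ (s : ℤ) (u : Fin 3 → ℤ) , 0 < s → (∀ l : ℤ, (∀ i, s ∣ l * u i) → s ∣ l) →
      s ^ 2 ∣ qf c u → ∃ (Y : Fin 3 → Fin 3 → ℤ) (G : Fin 3 → Fin 3 → ℤ) (β : Fin 3 → ℤ),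
        (∀ k l, bf c (Y k) (Y l) = s ^ 2 * G k l) ∧ (∀ k l, |G k l| ≤ B) ∧
        (∀ k, bf c (Y k) u = s ^ 2 * β k) ∧ (Matrix.of Y).det ≠ 0 := by
  obtain ⟨R, hR, hsv⟩ := short_vec c hc
  have hsum : 0 < ∑ i, c i := Finset.sum_pos (fun i _ => hc i) ⟨0, Finset.mem_univ _⟩
  refine ⟨(∑ i, c i) * R ^ 2, by positivity, ?_⟩
  intro s u hs hprim hu
  -- reformulate
  have sv : ∀ h : Fin 3 → ℤ, h ≠ 0 → ∃ Y : Fin 3 → ℤ, (∃ (C : Fin 3 → ℤ) (l : ℤ), s ∣ bf c u C ∧ Y = fun i => s * C i + l * u i) ∧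
      (∀ i, |Y i| < R * s) ∧ ∑ i, h i * Y i ≠ 0 := by
    intro h hh
    obtain ⟨C, l, h1, h2, h3⟩ := hsv s u h hs hprim hu hh
    exact ⟨_, ⟨C, l, h1, rfl⟩, h2, h3⟩
  obtain ⟨Y0, hY0, hb0, hn0⟩ := sv ![1, 0, 0] (by intro h; simpa using congrFun h 0)
  simp [Fin.sum_univ_three] at hn0
  obtain ⟨Y1, hY1, hb1, hn1⟩ := sv ![-Y0 1, Y0 0, 0] (by intro h; exact hn0 (by simpa using congrFun h 1))
  simp [Fin.sum_univ_three] at hn1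
  obtain ⟨Y2, hY2, hb2, hn2⟩ := sv ![Y0 1 * Y1 2 - Y0 2 * Y1 1, Y0 2 * Y1 0 - Y0 0 * Y1 2, Y0 0 * Y1 1 - Y0 1 * Y1 0]
    (by intro h
        have := congrFun h 2
        simp at this
        apply hn1; linarith)
  simp [Fin.sum_univ_three] at hn2
  have hall : ∀ k, (∃ (C : Fin 3 → ℤ) (l : ℤ), s ∣ bf c u C ∧ (![Y0, Y1, Y2] : Fin 3 → Fin 3 → ℤ) k = fun i => s * C i + l * u i) ∧
      (∀ i, |(![Y0, Y1, Y2] : Fin 3 → Fin 3 → ℤ) k i| < R * s) := by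
    intro k
    fin_cases k
    · exact ⟨hY0, hb0⟩
    · exact ⟨hY1, hb1⟩
    · exact ⟨hY2, hb2⟩
  obtain ⟨Y, hY⟩ : ∃ Y : Fin 3 → Fin 3 → ℤ, Y = ![Y0, Y1, Y2] := ⟨_, rfl⟩
  have hdet : (Matrix.of Y).det ≠ 0 := by
    rw [Matrix.det_fin_three, hY]
    simp only [Matrix.of_apply, Matrix.cons_val_zero, Matrix.cons_val_one, Matrix.cons_val]
    intro h; apply hn2; linarith
  rw [← hY] at hall
  have hGd : ∀ k l, ∃ g, bf c (Y k) (Y l) = s ^ 2 * g := by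
    intro k l
    obtain ⟨⟨C, x, ⟨e, he⟩, hC⟩, -⟩ := hall k
    obtain ⟨⟨C', x', ⟨e', he'⟩, hC'⟩, -⟩ := hall l
    obtain ⟨q, hq⟩ := hu
    refine ⟨bf c C C' + x' * e + x * e' + x * x' * q, ?_⟩
    have e1 : bf c (Y k) (Y l) = s ^ 2 * bf c C C' + s * x' * bf c u C + s * x * bf c u C' + x * x' * qf c u := by
      rw [hC, hC']
      simp only [bf, qf, Fin.sum_univ_three]; ring
    rw [e1, he, he', hq]; ring
  have hβd : ∀ k, ∃ g, bf c (Y k) u = s ^ 2 * g := by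
    intro k
    obtain ⟨⟨C, x, ⟨e, he⟩, hC⟩, -⟩ := hall k
    obtain ⟨q, hq⟩ := hu
    refine ⟨e + x * q, ?_⟩
    have e1 : bf c (Y k) u = s * bf c u C + x * qf c u := by
      rw [hC]
      simp only [bf, qf, Fin.sum_univ_three]; ring
    rw [e1, he, hq]; ring
  choose G hG using hGd
  choose β hβ using hβd
  refine ⟨Y, G, β, hG, ?_, hβ, hdet⟩
  intro k l
  have h1 : |bf c (Y k) (Y l)| ≤ (∑ i, c i) * R ^ 2 * s ^ 2 := by
    calc |bf c (Y k) (Y l)| ≤ ∑ i, |c i * Y k i * Y l i| := Finset.abs_sum_le_sum_abs _ _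
      _ ≤ ∑ i, c i * (R * s) ^ 2 := by
        apply Finset.sum_le_sum
        intro i _
        rw [abs_mul, abs_mul, abs_of_pos (hc i), mul_assoc, sq]
        have := ((hall k).2 i).le
        have := ((hall l).2 i).le
        have := hc i
        gcongr
      _ = _ := by rw [← Finset.sum_mul]; ring
  rw [hG, abs_mul, abs_of_pos (by positivity : 0 < s ^ 2)] at h1
  have h2 : s ^ 2 * |G k l| ≤ s ^ 2 * ((∑ i, c i) * R ^ 2) := by linarith
  exact le_of_mul_le_mul_left h2 (by positivity)

theorem bounded_denoms_prim (c : Fin 3 → ℤ) (hc : ∀ i, 0 < c i) (p : ℕ) (hp : p.Prime) (J : ℕ) :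
    ∃ S : ℤ, ¬ (p:ℤ) ∣ S ∧ ∀ (u : Fin 3 → ℤ) (s n : ℤ), 0 < s → ¬ (p:ℤ) ∣ s → qf c u = n * s ^ 2 →
      (∀ l : ℤ, (∀ i, s ∣ l * u i) → s ∣ l) →
      ∃ V : Fin 3 → ℤ, qf c V = S ^ 2 * n ∧ ∀ i, (p:ℤ) ^ J ∣ s * V i - S * u i := by
  classical
  have hpp := Nat.prime_iff_prime_int.1 hp
  have hp0 : (p:ℤ) ≠ 0 := hpp.ne_zero
  have hppos : (0:ℤ) < p := by exact_mod_cast hp.pos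
  obtain ⟨B, hB, hbasis⟩ := exists_basis c hc
  let GS : Finset (Fin 3 → Fin 3 → ℤ) := Fintype.piFinset (fun _ => Fintype.piFinset (fun _ => Finset.Icc (-B) B))
  obtain ⟨B0, hB0⟩ : ∃ B0 : ℕ, ∀ G ∈ GS, (Matrix.of G).det.natAbs ≤ B0 :=
    ⟨∑ G ∈ GS, (Matrix.of G).det.natAbs, fun G hG =>
      Finset.single_le_sum (f := fun G : Fin 3 → Fin 3 → ℤ => (Matrix.of G).det.natAbs) (fun _ _ => Nat.zero_le _) hG⟩
  obtain ⟨L, hL⟩ : ∃ L : ℕ, L = B0 + J := ⟨_, rfl⟩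
  let RS : Finset (Fin 3 → Fin 3 → ℤ) := Fintype.piFinset (fun _ => Fintype.piFinset (fun _ => Finset.Ico 0 ((p:ℤ) ^ L)))
  -- the constant for each type
  have htype : ∀ τ : (Fin 3 → Fin 3 → ℤ) × (Fin 3 → Fin 3 → ℤ), ∃ S : ℤ, ¬ (p:ℤ) ∣ S ∧ (τ.1 ∈ GS →
      ∀ (s : ℤ) (Y : Fin 3 → Fin 3 → ℤ) (u β : Fin 3 → ℤ) (n : ℤ), TypeData c p L τ.1 τ.2 s Y →
      qf c u = n * s ^ 2 → (∀ k, bf c (Y k) u = s ^ 2 * β k) →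
      ∃ V : Fin 3 → ℤ, qf c V = S ^ 2 * n ∧ ∀ i, (p:ℤ) ^ J ∣ s * V i - S * u i) := by
    rintro ⟨G, ρ⟩
    by_cases hex : ∃ s' Y', TypeData c p L G ρ s' Y'
    · obtain ⟨s', Y', h'⟩ := hex
      obtain ⟨j, Δ', hΔ, hpΔ⟩ := exists_pow_mul p hp _ (h'.det_ne hc)
      refine ⟨s' * Δ', ?_, ?_⟩
      · intro hd
        rcases hpp.dvd_or_dvd hd with h1 | h1
        · exact h'.2.1 h1
        · exact hpΔ h1
      · intro hG s Y u β n h hu hβ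
        refine transfer c hc p hp L J j G ρ s s' Y Y' h h' Δ' hΔ ?_ u β n hu hβ
        have h1 := hB0 G hG
        have h2 : j < p ^ j := Nat.lt_pow_self hp.one_lt
        have h3 : p ^ j ≤ (Matrix.of G).det.natAbs := by
          apply Nat.le_of_dvd (Int.natAbs_pos.2 (h'.det_ne hc))
          rw [← Int.natCast_dvd]
          rw [hΔ]; push_cast; exact dvd_mul_right _ _
        omega
    · exact ⟨1, fun h => hpp.not_isUnit (isUnit_of_dvd_one h), fun _ s Y u β n h => absurd ⟨s, Y, h⟩ hex⟩
  choose Sf hSf1 hSf2 using htype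
  refine ⟨∏ τ ∈ GS ×ˢ RS, Sf τ, ?_, ?_⟩
  · rw [hpp.dvd_finsetProd_iff]
    rintro ⟨τ, -, hτ⟩
    exact hSf1 τ hτ
  · intro u s n hs hps hu hprim
    obtain ⟨Y, G, β, hG, hGB, hβ, hdet⟩ := hbasis s u hs hprim ⟨n, by rw [hu]; ring⟩
    have hcp : IsCoprime s ((p:ℤ) ^ L) := (IsCoprime.pow_left ((hpp.coprime_iff_not_dvd).2 hps)).symm
    obtain ⟨v, w, hvw⟩ := hcp
    obtain ⟨ρ, hρ⟩ : ∃ ρ : Fin 3 → Fin 3 → ℤ, ρ = fun k i => (Y k i * v) % ((p:ℤ) ^ L) := ⟨_, rfl⟩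
    have hGm : G ∈ GS := by
      simp only [GS, Fintype.mem_piFinset, Finset.mem_Icc]
      intro k l
      exact abs_le.1 (hGB k l)
    have hρm : ρ ∈ RS := by
      simp only [RS, Fintype.mem_piFinset, Finset.mem_Ico]
      intro k i
      rw [hρ]
      exact ⟨Int.emod_nonneg _ (by positivity), Int.emod_lt_of_pos _ (by positivity)⟩
    have hτ : (G, ρ) ∈ GS ×ˢ RS := Finset.mem_product.2 ⟨hGm, hρm⟩
    have hT : TypeData c p L G ρ s Y := by
      refine ⟨hs, hps, hG, ?_, hdet⟩
      intro k i
      rw [hρ]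
      simp only
      have h1 := Int.emod_add_mul_ediv (Y k i * v) ((p:ℤ) ^ L)
      refine ⟨Y k i * w + s * (Y k i * v / (p:ℤ) ^ L), ?_⟩
      have e : Y k i * v % (p:ℤ) ^ L = Y k i * v - (p:ℤ) ^ L * (Y k i * v / (p:ℤ) ^ L) := by linarith
      rw [e]; linear_combination (-Y k i) * hvw
    obtain ⟨V, hV1, hV2⟩ := hSf2 (G, ρ) hGm s Y u β n hT hu hβ
    obtain ⟨k, hk⟩ := Finset.dvd_prod_of_mem Sf hτ
    refine ⟨fun i => k * V i + 0 * V i, ?_, ?_⟩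
    · rw [qf_lin, hV1, hk]; ring
    · intro i
      obtain ⟨e, he⟩ := hV2 i
      exact ⟨k * e, by rw [hk]; linear_combination k * he⟩

theorem bounded_denoms (c : Fin 3 → ℤ) (hc : ∀ i, 0 < c i) (p : ℕ) (hp : p.Prime) (J : ℕ) :
    ∃ S : ℤ, ¬ (p:ℤ) ∣ S ∧ ∀ (u : Fin 3 → ℤ) (s n : ℤ), 0 < s → ¬ (p:ℤ) ∣ s → qf c u = n * s ^ 2 →
      ∃ V : Fin 3 → ℤ, qf c V = S ^ 2 * n ∧ ∀ i, (p:ℤ) ^ J ∣ s * V i - S * u i := by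
  obtain ⟨S, hS, hmain⟩ := bounded_denoms_prim c hc p hp J
  refine ⟨S, hS, ?_⟩
  have key : ∀ (N : ℕ) (u : Fin 3 → ℤ) (s n : ℤ), s.natAbs = N → 0 < s → ¬ (p:ℤ) ∣ s → qf c u = n * s ^ 2 →
      ∃ V : Fin 3 → ℤ, qf c V = S ^ 2 * n ∧ ∀ i, (p:ℤ) ^ J ∣ s * V i - S * u i := by
    intro N
    induction N using Nat.strong_induction_on with
    | _ N ih =>
      intro u s n hN hs hps hu
      by_cases hprim : ∀ l : ℤ, (∀ i, s ∣ l * u i) → s ∣ l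
      · exact hmain u s n hs hps hu hprim
      · push Not at hprim
        obtain ⟨l, hl1, hl2⟩ := hprim
        have hg0 : 0 < Int.gcd s l := Int.gcd_pos_of_ne_zero_left _ hs.ne'
        obtain ⟨s1, l1, hcop, hs1, hl⟩ := Int.exists_gcd_one hg0
        have hg0' : (0:ℤ) < (Int.gcd s l : ℤ) := by exact_mod_cast hg0
        generalize (Int.gcd s l : ℤ) = g at hs1 hl hg0'
        have hcop' : IsCoprime s1 l1 := Int.isCoprime_iff_gcd_eq_one.2 hcop
        have hs1pos : 0 < s1 := by
          rw [hs1] at hs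
          exact pos_of_mul_pos_left hs hg0'.le
        have hdvd : ∀ i, s1 ∣ u i := by
          intro i
          have h1 := hl1 i
          rw [hl, hs1] at h1
          have h2 : g * s1 ∣ g * (l1 * u i) := by
            convert h1 using 1 <;> ring
          exact hcop'.dvd_of_dvd_mul_left ((mul_dvd_mul_iff_left hg0'.ne').1 h2)
        have hs11 : s1 ≠ 1 := by
          rintro rfl
          apply hl2
          rw [hs1, hl, one_mul]
          exact dvd_mul_left _ _
        choose u' hu' using hdvd
        have hlt : g < s := by
          rw [hs1]; nlinarith [lt_of_le_of_ne hs1pos (Ne.symm hs11)]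
        have hpg : ¬ (p:ℤ) ∣ g := fun h => hps (hs1 ▸ h.mul_left _)
        have hq : qf c u' = n * g ^ 2 := by
          have e : qf c u = s1 ^ 2 * qf c u' := by
            simp only [qf, Finset.mul_sum]
            refine Finset.sum_congr rfl fun i _ => ?_
            rw [hu' i]; ring
          rw [e, hs1] at hu
          have : s1 ^ 2 ≠ 0 := pow_ne_zero _ hs1pos.ne'
          apply mul_left_cancel₀ this
          rw [hu]; ring
        obtain ⟨V, hV1, hV2⟩ := ih g.natAbs (by omega) u' g n rfl hg0' hpg hq
        refine ⟨V, hV1, fun i => ?_⟩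
        have := (hV2 i).mul_left s1
        rw [hs1, hu' i]
        have e : s1 * g * V i - S * (s1 * u' i) = s1 * (g * V i - S * u' i) := by ring
        rw [e]; exact this
  intro u s n
  exact key _ u s n rfl


theorem dvd_cast {x y z : ℤ} (h : x ∣ y) (e : z = y) : x ∣ z := e ▸ h

theorem solve_cong (m M r : ℤ) (h : IsCoprime m M) : ∃ t : ℤ, M ∣ m * t - r := by
  obtain ⟨x, y, hxy⟩ := h
  refine ⟨x * r, -(y * r), ?_⟩
  linear_combination r * hxy

theorem crt_pos (M1 M2 r1 r2 : ℤ) (h1 : M1 ≠ 0) (h2 : M2 ≠ 0) (h : IsCoprime M1 M2) (B : ℤ) :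
    ∃ t : ℤ, B < t ∧ M1 ∣ t - r1 ∧ M2 ∣ t - r2 := by
  obtain ⟨x, y, hxy⟩ := h
  set t0 := r2 * x * M1 + r1 * y * M2 with ht0
  have hM : 1 ≤ (M1 * M2) ^ 2 := by
    have : 0 < (M1 * M2) ^ 2 := by positivity
    omega
  refine ⟨t0 + (M1 * M2) ^ 2 * (|t0| + |B| + 1), ?_, ?_, ?_⟩
  · have := neg_abs_le t0
    have := le_abs_self B
    have := abs_nonneg t0
    have := abs_nonneg B
    nlinarith
  · exact ⟨(r2 - r1) * x + M1 * M2 ^ 2 * (|t0| + |B| + 1), by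
      rw [ht0]; linear_combination r1 * hxy⟩
  · exact ⟨(r1 - r2) * y + M1 ^ 2 * M2 * (|t0| + |B| + 1), by
      rw [ht0]; linear_combination r2 * hxy⟩

theorem hensel_qf {ι : Type} [Fintype ι] [DecidableEq ι] (c : ι → ℤ) (p : ℕ) (hp : p.Prime) (d : ℤ) (y0 : ι → ℤ) (i : ι)
    (K g : ℕ) (hg : ¬ (p:ℤ) ^ (g + 1) ∣ 2 * c i * y0 i) (h : (p:ℤ) ^ K ∣ qf c y0 - d) (hK : 2 * g < K) (K' : ℕ) :
    ∃ y : ι → ℤ, (p:ℤ) ^ K' ∣ qf c y - d ∧ ∀ j, (p:ℤ) ^ (K - g) ∣ y j - y0 j := by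
  have key : ∀ t, qf c (Function.update y0 i t) = qf c y0 - c i * y0 i ^ 2 + c i * t ^ 2 := by
    intro t
    simp only [qf]
    rw [← Finset.add_sum_erase _ _ (Finset.mem_univ i), ← Finset.add_sum_erase _ (fun j => c j * y0 j ^ 2) (Finset.mem_univ i)]
    rw [Finset.sum_congr rfl (g := fun j => c j * y0 j ^ 2)]
    · simp; ring
    · intro j hj
      rw [Function.update_of_ne (Finset.ne_of_mem_erase hj)]
  obtain ⟨t, ht1, ht2⟩ := hensel_sq p hp (c i) (y0 i) (d - qf c y0 + c i * y0 i ^ 2) K g hg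
    (by convert h using 1; ring) hK K'
  refine ⟨Function.update y0 i t, ?_, ?_⟩
  · rw [key]; convert ht1 using 1; ring
  · intro j
    by_cases hj : j = i
    · subst hj; simpa using ht2
    · rw [Function.update_of_ne hj]; simp

theorem prime_coprime_of_not_dvd {p : ℕ} (hp : p.Prime) {x : ℤ} (h : ¬ (p:ℤ) ∣ x) : IsCoprime (p:ℤ) x :=
  (Prime.coprime_iff_not_dvd (Nat.prime_iff_prime_int.1 hp)).2 h

theorem lift_p_sq (a b : ℤ) (ha : 0 < a) (hb : 0 < b) (hab : 1 < a * b) (p : ℕ) (hp : p.Prime)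
    (hpab : ¬ (p:ℤ) ∣ 2 * a * b) (X0 : ℤ) (v0 : Fin 3 → ℤ) (i0 : Fin 3) (hi0 : ¬ (p:ℤ) ∣ v0 i0)
    (h0 : (p:ℤ) ^ 3 ∣ X0 ^ 2 - qf ![a, b, a * b] v0 - (p:ℤ) ^ 2) :
    ∃ (X : ℤ) (v : Fin 3 → ℤ), X ^ 2 - qf ![a, b, a * b] v = (p:ℤ) ^ 2 ∧ (p:ℤ) ^ 3 ∣ X - X0 ∧
      ∀ i, (p:ℤ) ^ 3 ∣ v i - v0 i := by
  have hpp := Nat.prime_iff_prime_int.1 hp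
  have hppos : (0:ℤ) < p := by exact_mod_cast hp.pos
  have hp2 : ¬ (p:ℤ) ∣ 2 := fun h => hpab ((h.mul_right a).mul_right b)
  have hpa : ¬ (p:ℤ) ∣ a := fun h => hpab ((h.mul_left 2).mul_right b)
  have hpb : ¬ (p:ℤ) ∣ b := fun h => hpab (h.mul_left _)
  have h8 : ¬ (p:ℤ) ∣ 8 := fun h => hp2 (hpp.dvd_of_dvd_pow (n := 3) (by norm_num; exact h))
  have hc : ∀ i, 0 < (![a, b, a * b] : Fin 3 → ℤ) i := by
    intro i; fin_cases i <;> simp <;> positivity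
  have hpc : ∀ i, ¬ (p:ℤ) ∣ (![a, b, a * b] : Fin 3 → ℤ) i := by
    intro i; fin_cases i
    · simpa using hpa
    · simpa using hpb
    · simpa using fun h => (hpp.dvd_or_dvd h).elim hpa hpb
  set c : Fin 3 → ℤ := ![a, b, a * b] with hcdef
  obtain ⟨S0, hS0, hBD⟩ := bounded_denoms c hc p hp 3
  set k : ℤ := 8 * a * b with hk
  set S : ℤ := k * S0 with hS
  have hpk : ¬ (p:ℤ) ∣ k := fun h => (hpp.dvd_or_dvd h).elim
    (fun h => (hpp.dvd_or_dvd h).elim h8 hpa) hpb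
  have hpS : ¬ (p:ℤ) ∣ S := fun h => (hpp.dvd_or_dvd h).elim hpk hS0
  have hSne : S ≠ 0 := fun h => hpS (h ▸ dvd_zero _)
  have hp2S : ¬ (p:ℤ) ∣ 2 * S := fun h => (hpp.dvd_or_dvd h).elim hp2 hpS
  have hp2S2 : ¬ (p:ℤ) ∣ 2 * S ^ 2 := fun h => (hpp.dvd_or_dvd h).elim hp2 (fun h => hpS (hpp.dvd_of_dvd_pow h))
  have hpM : ¬ (p:ℤ) ∣ 8 * a ^ 2 * b := fun h => (hpp.dvd_or_dvd h).elim
    (fun h => (hpp.dvd_or_dvd h).elim h8 (fun h => hpa (hpp.dvd_of_dvd_pow h))) hpb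
  obtain ⟨κ1, hκ1⟩ := solve_cong (2 * S ^ 2) ((p:ℤ) ^ 3) (X0 - p)
    (prime_coprime_of_not_dvd hp hp2S2).symm.pow_right
  obtain ⟨κ2, hκ2⟩ := solve_cong (p:ℤ) (8 * a ^ 2 * b) a (prime_coprime_of_not_dvd hp hpM)
  obtain ⟨κ, hκpos, hκa, hκb⟩ := crt_pos ((p:ℤ) ^ 3) (8 * a ^ 2 * b) κ1 κ2 (by positivity) (by positivity)
    (prime_coprime_of_not_dvd hp hpM).pow_left 0
  set n : ℤ := κ * (p + S ^ 2 * κ) with hn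
  have hnpos : 0 < n := by positivity
  set X : ℤ := p + 2 * S ^ 2 * κ with hX
  have hXn : X ^ 2 - p ^ 2 = 4 * S ^ 2 * n := by rw [hX, hn]; ring
  have hXX0 : (p:ℤ) ^ 3 ∣ X - X0 := by
    have := dvd_add hκ1 (hκa.mul_left (2 * S ^ 2))
    exact dvd_cast this (by rw [hX]; ring)
  have hna : 8 * a * b * a ∣ a * 1 + a * b * 0 ^ 2 - n := by
    have h1 : 8 * a ^ 2 * b ∣ a - n := by
      have e : a - n = -((p * κ2 - a) + p * (κ - κ2) + (8 * a ^ 2 * b) * (8 * b * S0 ^ 2 * κ ^ 2)) := by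
        rw [hn, hS, hk]; ring
      rw [e, dvd_neg]
      exact dvd_add (dvd_add hκ2 (hκb.mul_left _)) (dvd_mul_right _ _)
    convert h1 using 1 <;> ring
  obtain ⟨y, z, w, s, hs0, hs⟩ := ternary_rational a b n 1 0 0 a 1 1 ha hb hab hnpos (by ring) ha
    (by rw [pow_one]; exact ⟨2 * b, by ring⟩) one_pos isCoprime_one_left isCoprime_one_right hna
  have hqf : ∀ v : Fin 3 → ℤ, qf c v = a * v 0 ^ 2 + b * v 1 ^ 2 + a * b * v 2 ^ 2 := by
    intro v; simp [qf, hcdef, Fin.sum_univ_three]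
  choose y0 hy0 using fun i => solve_cong (2 * S) ((p:ℤ) ^ 3) (v0 i) (prime_coprime_of_not_dvd hp hp2S).symm.pow_right
  have hcop4 : IsCoprime ((p:ℤ) ^ 3) (4 * S ^ 2) := by
    have := (prime_coprime_of_not_dvd hp hp2S).pow (m := 3) (n := 2)
    convert this using 1; ring
  have hy0n : (p:ℤ) ^ 3 ∣ qf c y0 - n := by
    refine hcop4.dvd_of_dvd_mul_left ?_
    have h1 : (p:ℤ) ^ 3 ∣ X ^ 2 - X0 ^ 2 := hXX0.trans ⟨X + X0, by ring⟩
    have h2 : (p:ℤ) ^ 3 ∣ 4 * S ^ 2 * qf c y0 - qf c v0 := by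
      have e : 4 * S ^ 2 * qf c y0 - qf c v0 = a * ((2 * S * y0 0 - v0 0) * (2 * S * y0 0 + v0 0))
        + b * ((2 * S * y0 1 - v0 1) * (2 * S * y0 1 + v0 1)) + a * b * ((2 * S * y0 2 - v0 2) * (2 * S * y0 2 + v0 2)) := by
        rw [hqf, hqf]; ring
      rw [e]
      exact dvd_add (dvd_add (((hy0 0).mul_right _).mul_left _) (((hy0 1).mul_right _).mul_left _))
        (((hy0 2).mul_right _).mul_left _)
    have e : 4 * S ^ 2 * (qf c y0 - n) = (4 * S ^ 2 * qf c y0 - qf c v0) - (X ^ 2 - X0 ^ 2)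
      - (X0 ^ 2 - qf c v0 - (p:ℤ) ^ 2) := by linear_combination hXn
    rw [e]
    exact dvd_sub (dvd_sub h2 h1) h0
  have hpy0 : ¬ (p:ℤ) ∣ 2 * c i0 * y0 i0 := by
    intro h
    rcases hpp.dvd_or_dvd h with h | h
    · exact (hpp.dvd_or_dvd h).elim hp2 (hpc i0)
    · apply hi0
      have h1 : (p:ℤ) ∣ 2 * S * y0 i0 - v0 i0 := (dvd_pow_self _ (by norm_num)).trans (hy0 i0)
      have := dvd_sub (h.mul_left (2 * S)) h1
      simpa using this
  obtain ⟨U, m', hU, -, hm', hUc⟩ := weak_approx c ![y, z, w] n s (by rw [hqf]; simpa using hs) hs0 hnpos.ne' p hp 1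
    isCoprime_one_right isCoprime_one_right 0 isCoprime_one_right 3 y0
    (fun K => by
      have := hensel_qf c p hp n y0 i0 3 0 (by simpa using hpy0) hy0n (by norm_num) K
      simpa using this)
  have hV : ∃ V : Fin 3 → ℤ, qf c V = S0 ^ 2 * n ∧ ∀ i, (p:ℤ) ^ 3 ∣ m' * V i - S0 * U i := by
    have hm0 : m' ≠ 0 := fun h => hm' (h ▸ dvd_zero _)
    rcases lt_or_gt_of_ne hm0 with h | h
    · obtain ⟨V, h1, h2⟩ := hBD (fun i => - U i) (-m') n (by linarith) (by rwa [dvd_neg]) (by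
        have : qf c (fun i => - U i) = qf c U := by simp [qf]
        rw [this, hU]; ring)
      refine ⟨V, h1, fun i => ?_⟩
      have := (h2 i)
      rw [← dvd_neg]
      exact dvd_cast this (by ring)
    · exact hBD U m' n h hm' hU
  obtain ⟨V, hV1, hV2⟩ := hV
  have hV3 : ∀ i, (p:ℤ) ^ 3 ∣ V i - S0 * y0 i := by
    intro i
    refine ((prime_coprime_of_not_dvd hp hm').pow_left (m := 3)).dvd_of_dvd_mul_left ?_
    have := dvd_add (hV2 i) ((hUc i).mul_left S0)
    exact dvd_cast this (by ring)
  refine ⟨X, fun i => 2 * k * V i, ?_, hXX0, fun i => ?_⟩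
  · have e : qf c (fun i => 2 * k * V i) = 4 * k ^ 2 * qf c V := by rw [hqf, hqf]; ring
    rw [e, hV1]
    linear_combination hXn + 4 * (S + k * S0) * n * hS
  · have := dvd_add ((hV3 i).mul_left (2 * k)) (hy0 i)
    exact dvd_cast this (by rw [hS]; ring)


theorem perp_aux {p : ℕ} [Fact p.Prime] (a b d u0 u1 u2 u3 : ZMod p) (h2 : (2 : ZMod p) ≠ 0) (ha : a ≠ 0) (hb : b ≠ 0)
    (hu : ¬ (u0 = 0 ∧ u1 = 0 ∧ u2 = 0 ∧ u3 = 0))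
    (hf : u0 ^ 2 - a * u1 ^ 2 - b * u2 ^ 2 - a * b * u3 ^ 2 = 0) :
    ∃ y0 y1 y2 y3 : ZMod p, u0 * y0 - a * u1 * y1 - b * u2 * y2 - a * b * u3 * y3 = 0 ∧
      y0 ^ 2 - a * y1 ^ 2 - b * y2 ^ 2 - a * b * y3 ^ 2 = d := by
  by_cases h1 : u0 ^ 2 - a * u1 ^ 2 = 0
  · by_cases h3 : u0 ^ 2 - b * u2 ^ 2 = 0
    · by_cases h4 : u0 ^ 2 - a * b * u3 ^ 2 = 0
      · exfalso
        have e : 2 * u0 ^ 2 = 0 := by linear_combination -hf + h1 + h3 + h4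
        have e0 : u0 = 0 := by simpa [h2] using e
        subst e0
        apply hu
        refine ⟨rfl, ?_, ?_, ?_⟩
        · simpa [ha] using h1
        · simpa [hb] using h3
        · simpa [ha, hb] using h4
      · obtain ⟨s, t, hst⟩ := ZMod.sq_add_sq p (d / (-(a * b * (u0 ^ 2 - a * b * u3 ^ 2))))
        have hne : -(a * b * (u0 ^ 2 - a * b * u3 ^ 2)) ≠ 0 := neg_ne_zero.2 (mul_ne_zero (mul_ne_zero ha hb) h4)
        rw [eq_div_iff hne] at hst
        refine ⟨s * (a * b * u3), t * (b * u2), -(t * (a * u1)), s * u0, by ring, ?_⟩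
        linear_combination hst + a * b * t ^ 2 * hf
    · obtain ⟨s, t, hst⟩ := ZMod.sq_add_sq p (d / (-(b * (u0 ^ 2 - b * u2 ^ 2))))
      have hne : -(b * (u0 ^ 2 - b * u2 ^ 2)) ≠ 0 := neg_ne_zero.2 (mul_ne_zero hb h3)
      rw [eq_div_iff hne] at hst
      refine ⟨s * (b * u2), t * (b * u3), s * u0, -(t * u1), by ring, ?_⟩
      linear_combination hst + b * t ^ 2 * hf
  · obtain ⟨s, t, hst⟩ := ZMod.sq_add_sq p (d / (-(a * (u0 ^ 2 - a * u1 ^ 2))))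
    have hne : -(a * (u0 ^ 2 - a * u1 ^ 2)) ≠ 0 := neg_ne_zero.2 (mul_ne_zero ha h1)
    rw [eq_div_iff hne] at hst
    refine ⟨s * (a * u1), s * u0, t * (a * u3), -(t * u2), by ring, ?_⟩
    linear_combination hst + a * t ^ 2 * hf

theorem perp_int (a b d u0 u1 u2 u3 : ℤ) (p : ℕ) (hp : p.Prime)
    (hpab : ¬ (p:ℤ) ∣ 2 * a * b) (hu : ¬ ((p:ℤ) ∣ u0 ∧ (p:ℤ) ∣ u1 ∧ (p:ℤ) ∣ u2 ∧ (p:ℤ) ∣ u3))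
    (hf : (p:ℤ) ∣ u0 ^ 2 - a * u1 ^ 2 - b * u2 ^ 2 - a * b * u3 ^ 2) :
    ∃ y0 y1 y2 y3 : ℤ, (p:ℤ) ∣ u0 * y0 - a * u1 * y1 - b * u2 * y2 - a * b * u3 * y3 ∧
      (p:ℤ) ∣ y0 ^ 2 - a * y1 ^ 2 - b * y2 ^ 2 - a * b * y3 ^ 2 - d := by
  haveI : Fact p.Prime := ⟨hp⟩
  have hp2 : ¬ (p:ℤ) ∣ 2 := fun h => hpab ((h.mul_right a).mul_right b)
  have hpa : ¬ (p:ℤ) ∣ a := fun h => hpab ((h.mul_left 2).mul_right b)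
  have hpb : ¬ (p:ℤ) ∣ b := fun h => hpab (h.mul_left _)
  simp only [← ZMod.intCast_zmod_eq_zero_iff_dvd] at *
  push_cast at *
  obtain ⟨y0, y1, y2, y3, h1, h2⟩ := perp_aux (a : ZMod p) b d u0 u1 u2 u3 hp2 hpa hpb hu hf
  obtain ⟨y0, rfl⟩ := ZMod.intCast_surjective y0
  obtain ⟨y1, rfl⟩ := ZMod.intCast_surjective y1
  obtain ⟨y2, rfl⟩ := ZMod.intCast_surjective y2
  obtain ⟨y3, rfl⟩ := ZMod.intCast_surjective y3
  exact ⟨y0, y1, y2, y3, h1, by rw [h2, sub_self]⟩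

theorem remove_prime (a b : ℤ) (ha : 0 < a) (hb : 0 < b) (hab : 1 < a * b) (p : ℕ) (hp : p.Prime)
    (hpab : ¬ (p:ℤ) ∣ 2 * a * b) (d u0 u1 u2 u3 : ℤ)
    (hf : u0 ^ 2 - a * u1 ^ 2 - b * u2 ^ 2 - a * b * u3 ^ 2 = d * (p:ℤ) ^ 2) :
    ∃ x y z w : ℤ, x ^ 2 - a * y ^ 2 - b * z ^ 2 - a * b * w ^ 2 = d := by
  have hpp := Nat.prime_iff_prime_int.1 hp
  have hp0 : (p:ℤ) ≠ 0 := hpp.ne_zero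
  have hp2 : ¬ (p:ℤ) ∣ 2 := fun h => hpab ((h.mul_right a).mul_right b)
  have hpa : ¬ (p:ℤ) ∣ a := fun h => hpab ((h.mul_left 2).mul_right b)
  have hpb : ¬ (p:ℤ) ∣ b := fun h => hpab (h.mul_left _)
  by_cases hu : (p:ℤ) ∣ u0 ∧ (p:ℤ) ∣ u1 ∧ (p:ℤ) ∣ u2 ∧ (p:ℤ) ∣ u3
  · obtain ⟨⟨x, rfl⟩, ⟨y, rfl⟩, ⟨z, rfl⟩, ⟨w, rfl⟩⟩ := hu
    refine ⟨x, y, z, w, mul_right_cancel₀ (pow_ne_zero 2 hp0) ?_⟩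
    rw [← hf]; ring
  obtain ⟨t0, t1, t2, t3, ⟨β00, hβ00⟩, hft⟩ := perp_int a b d u0 u1 u2 u3 p hp hpab hu (hf ▸ (dvd_pow_self _ (by norm_num)).mul_left _)
  -- some coordinate among u1, u2, u3 is a unit mod p
  have hu' : ¬ (p:ℤ) ∣ u1 ∨ ¬ (p:ℤ) ∣ u2 ∨ ¬ (p:ℤ) ∣ u3 := by
    by_contra hcon
    push Not at hcon
    obtain ⟨k1, k2, k3⟩ := hcon
    refine hu ⟨?_, k1, k2, k3⟩
    apply hpp.dvd_of_dvd_pow (n := 2)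
    have e : u0 ^ 2 = d * (p:ℤ) ^ 2 + a * u1 ^ 2 + b * u2 ^ 2 + a * b * u3 ^ 2 := by linarith
    rw [e]
    have hh : ∀ x : ℤ, (p:ℤ) ∣ x → (p:ℤ) ∣ x ^ 2 := fun x h => dvd_pow h (by norm_num)
    exact dvd_add (dvd_add (dvd_add ((hh _ dvd_rfl).mul_left _) ((hh _ k1).mul_left _)) ((hh _ k2).mul_left _)) ((hh _ k3).mul_left _)
  -- choose z with 2 B(u,z) ≡ 2 (d - β00) - 1
  obtain ⟨z1, z2, z3, hz⟩ : ∃ z1 z2 z3 : ℤ, (p:ℤ) ∣ 2 * (d - (β00 - a * u1 * z1 - b * u2 * z2 - a * b * u3 * z3)) - 1 := by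
    have nd : ∀ {x y : ℤ}, ¬ (p:ℤ) ∣ x → ¬ (p:ℤ) ∣ y → ¬ (p:ℤ) ∣ x * y := fun h1 h2 h => (hpp.dvd_or_dvd h).elim h1 h2
    rcases hu' with h | h | h
    · obtain ⟨t, ht⟩ := solve_cong (2 * a * u1) p (1 - 2 * (d - β00)) (prime_coprime_of_not_dvd hp (nd (nd hp2 hpa) h)).symm
      exact ⟨t, 0, 0, dvd_cast ht (by ring)⟩
    · obtain ⟨t, ht⟩ := solve_cong (2 * b * u2) p (1 - 2 * (d - β00)) (prime_coprime_of_not_dvd hp (nd (nd hp2 hpb) h)).symm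
      exact ⟨0, t, 0, dvd_cast ht (by ring)⟩
    · obtain ⟨t, ht⟩ := solve_cong (2 * (a * b) * u3) p (1 - 2 * (d - β00)) (prime_coprime_of_not_dvd hp (nd (nd hp2 (nd hpa hpb)) h)).symm
      exact ⟨0, 0, t, dvd_cast ht (by ring)⟩
  set s1 := t1 + p * z1 with hs1
  set s2 := t2 + p * z2 with hs2
  set s3 := t3 + p * z3 with hs3
  set β0 := β00 - a * u1 * z1 - b * u2 * z2 - a * b * u3 * z3 with hβ0
  have hB0 : u0 * t0 - a * u1 * s1 - b * u2 * s2 - a * b * u3 * s3 = p * β0 := by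
    rw [hs1, hs2, hs3, hβ0]; linear_combination hβ00
  have hfs : (p:ℤ) ∣ t0 ^ 2 - a * s1 ^ 2 - b * s2 ^ 2 - a * b * s3 ^ 2 - d := by
    have := dvd_sub hft (dvd_mul_right (p:ℤ) (a * z1 * (2 * t1 + p * z1) + b * z2 * (2 * t2 + p * z2) + a * b * z3 * (2 * t3 + p * z3)))
    exact dvd_cast this (by rw [hs1, hs2, hs3]; ring)
  clear_value s1 s2 s3 β0
  have hqf : ∀ v : Fin 3 → ℤ, qf ![a, b, a * b] v = a * v 0 ^ 2 + b * v 1 ^ 2 + a * b * v 2 ^ 2 := by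
    intro v; simp [qf, Fin.sum_univ_three]
  have hsub : ∀ x y : ℤ, ¬ (p:ℤ) ∣ x → ¬ (p:ℤ) ∣ x - p * y := fun x y h h' => h (by
    have := dvd_add h' (dvd_mul_right (p:ℤ) y)
    simpa using this)
  obtain ⟨i0, hi0⟩ : ∃ i0 : Fin 3, ¬ (p:ℤ) ∣ (![u1 - p * s1, u2 - p * s2, u3 - p * s3] : Fin 3 → ℤ) i0 := by
    rcases hu' with h | h | h
    · exact ⟨0, by simpa using hsub _ _ h⟩
    · exact ⟨1, by simpa using hsub _ _ h⟩
    · exact ⟨2, by simpa using hsub _ _ h⟩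
  obtain ⟨X, v, hXv, hX, hv⟩ := lift_p_sq a b ha hb hab p hp hpab (u0 - p * t0) _ i0 hi0 (by
    rw [hqf]
    obtain ⟨k1, hk1⟩ := hfs
    obtain ⟨k2, hk2⟩ := hz
    refine ⟨k1 + k2, ?_⟩
    simp
    linear_combination hf - 2 * p * hB0 + p ^ 2 * hk1 + p ^ 2 * hk2)
  rw [hqf] at hXv
  obtain ⟨r0, hr0⟩ := hX
  obtain ⟨r1, hr1⟩ := hv 0
  obtain ⟨r2, hr2⟩ := hv 1
  obtain ⟨r3, hr3⟩ := hv 2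
  simp at hr1 hr2 hr3
  obtain ⟨y0, hy0⟩ : ∃ y, y = t0 - p ^ 2 * r0 := ⟨_, rfl⟩
  obtain ⟨y1, hy1⟩ : ∃ y, y = s1 - p ^ 2 * r1 := ⟨_, rfl⟩
  obtain ⟨y2, hy2⟩ : ∃ y, y = s2 - p ^ 2 * r2 := ⟨_, rfl⟩
  obtain ⟨y3, hy3⟩ : ∃ y, y = s3 - p ^ 2 * r3 := ⟨_, rfl⟩
  obtain ⟨β, hβ⟩ : ∃ y, y = β0 - p * (u0 * r0 - a * u1 * r1 - b * u2 * r2 - a * b * u3 * r3) := ⟨_, rfl⟩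
  have e0 : X = u0 - p * y0 := by rw [hy0]; linear_combination hr0
  have e1 : v 0 = u1 - p * y1 := by rw [hy1]; linear_combination hr1
  have e2 : v 1 = u2 - p * y2 := by rw [hy2]; linear_combination hr2
  have e3 : v 2 = u3 - p * y3 := by rw [hy3]; linear_combination hr3
  have hB : u0 * y0 - a * u1 * y1 - b * u2 * y2 - a * b * u3 * y3 = p * β := by
    rw [hy0, hy1, hy2, hy3, hβ]; linear_combination hB0
  have hq : (p:ℤ) ∣ 2 * (d - β) - 1 := by
    have := dvd_add hz (dvd_mul_right (p:ℤ) (2 * (u0 * r0 - a * u1 * r1 - b * u2 * r2 - a * b * u3 * r3)))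
    exact dvd_cast this (by rw [hβ]; ring)
  rw [e0, e1, e2, e3] at hXv
  have hfy : y0 ^ 2 - a * y1 ^ 2 - b * y2 ^ 2 - a * b * y3 ^ 2 = 1 - d + 2 * β := by
    apply mul_left_cancel₀ (pow_ne_zero 2 hp0)
    linear_combination hXv - hf + 2 * p * hB
  obtain ⟨k, hk⟩ := hq
  obtain ⟨q, hqd⟩ : ∃ q, q = 2 * (d - β) := ⟨_, rfl⟩
  refine ⟨-k * u0 + q * y0, -k * u1 + q * y1, -k * u2 + q * y2, -k * u3 + q * y3, ?_⟩
  have hk' : p * k = q - 1 := by rw [hqd]; linarith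
  linear_combination k ^ 2 * hf - 2 * k * q * hB + q ^ 2 * hfy + d * (p * k + q - 1) * hk' - 2 * q * β * hk' + q * hqd


def LocSol (a b d : ℤ) (l : ℕ) : Prop := ∃ (X y z w : ℤ) (K : ℕ),
  (l:ℤ) ^ K ∣ X ^ 2 - a * y ^ 2 - b * z ^ 2 - a * b * w ^ 2 - d ∧ ¬ (l:ℤ) ^ K ∣ 8 * a * b * (a * y ^ 2 + b * z ^ 2)

theorem LocSol.swap {a b d : ℤ} {l : ℕ} (h : LocSol a b d l) : LocSol b a d l := by
  obtain ⟨X, y, z, w, K, h1, h2⟩ := h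
  refine ⟨X, z, y, w, K, dvd_cast h1 (by ring), fun h => h2 (dvd_cast h (by ring))⟩

theorem quad_rep (p : ℕ) (hp : p.Prime) (hp2 : p ≠ 2) (α β γ : ℤ) (hα : ¬ (p:ℤ) ∣ α) (hβ : ¬ (p:ℤ) ∣ β) :
    ∃ x y : ℤ, (p:ℤ) ∣ α * x ^ 2 + β * y ^ 2 - γ := by
  have : Fact p.Prime := ⟨hp⟩
  rw [← ZMod.intCast_zmod_eq_zero_iff_dvd] at hα hβ
  have hodd : Fintype.card (ZMod p) % 2 = 1 := by
    rw [ZMod.card]; exact hp.eq_two_or_odd.resolve_left hp2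
  obtain ⟨x, y, hxy⟩ := FiniteField.exists_root_sum_quadratic (R := ZMod p)
    (f := Polynomial.C (α : ZMod p) * Polynomial.X ^ 2 + Polynomial.C 0 * Polynomial.X + Polynomial.C (-γ : ZMod p))
    (g := Polynomial.C (β : ZMod p) * Polynomial.X ^ 2 + Polynomial.C 0 * Polynomial.X + Polynomial.C 0)
    (Polynomial.degree_quadratic hα) (Polynomial.degree_quadratic hβ) hodd
  obtain ⟨x, rfl⟩ := ZMod.intCast_surjective x
  obtain ⟨y, rfl⟩ := ZMod.intCast_surjective y
  refine ⟨x, y, ?_⟩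
  rw [← ZMod.intCast_zmod_eq_zero_iff_dvd]
  push_cast
  simp at hxy
  linear_combination hxy

theorem locSol_odd (a b d : ℤ) (l : ℕ) (hl : l.Prime) (hl2 : l ≠ 2) (hla : (l:ℤ) ∣ a) (hla2 : ¬ (l:ℤ) ^ 2 ∣ a)
    (hlb : ¬ (l:ℤ) ∣ b) (hld : ¬ (l:ℤ) ^ 2 ∣ d) : LocSol a b d l := by
  have hpp := Nat.prime_iff_prime_int.1 hl
  have hp0 : (l:ℤ) ≠ 0 := hpp.ne_zero
  have nd : ∀ {x y : ℤ}, ¬ (l:ℤ) ∣ x → ¬ (l:ℤ) ∣ y → ¬ (l:ℤ) ∣ x * y := fun h1 h2 h => (hpp.dvd_or_dvd h).elim h1 h2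
  have ndp : ∀ {x : ℤ} (n : ℕ), ¬ (l:ℤ) ∣ x → ¬ (l:ℤ) ∣ x ^ n := fun n h1 h2 => h1 (hpp.dvd_of_dvd_pow h2)
  have h2 : ¬ (l:ℤ) ∣ 2 := fun h => hl2 ((Nat.prime_dvd_prime_iff_eq hl Nat.prime_two).1 (by exact_mod_cast h))
  have h8 : ¬ (l:ℤ) ∣ 8 := fun h => h2 (hpp.dvd_of_dvd_pow (n := 3) (by norm_num; exact h))
  have cancel : ∀ (k : ℕ) (x : ℤ), ¬ (l:ℤ) ∣ x → ¬ (l:ℤ) ^ (k + 1) ∣ (l:ℤ) ^ k * x := by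
    intro k x hx h
    rw [pow_succ] at h
    exact hx ((mul_dvd_mul_iff_left (pow_ne_zero k hp0)).1 h)
  obtain ⟨a', rfl⟩ := hla
  have ha' : ¬ (l:ℤ) ∣ a' := fun h => hla2 (by rw [sq]; exact mul_dvd_mul_left _ h)
  by_cases hd : (l:ℤ) ∣ d
  · obtain ⟨d', rfl⟩ := hd
    have hd' : ¬ (l:ℤ) ∣ d' := fun h => hld (by rw [sq]; exact mul_dvd_mul_left _ h)
    obtain ⟨y, w, hyw⟩ := quad_rep l hl hl2 a' (a' * b) (-d') ha' (nd ha' hlb)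
    by_cases hy : (l:ℤ) ∣ y
    · have hw : ¬ (l:ℤ) ∣ w := by
        intro hw
        apply hd'
        have := dvd_sub hyw (dvd_add ((dvd_pow hy two_ne_zero).mul_left a') ((dvd_pow hw two_ne_zero).mul_left (a' * b)))
        exact dvd_cast this (by ring)
      obtain ⟨w', hw1, -⟩ := hensel_sq l hl (a' * b) w (-d' - b * l) 1 0
        (by rw [zero_add, pow_one]; exact nd (nd h2 (nd ha' hlb)) hw)
        (by
          rw [pow_one]
          have := dvd_add (dvd_sub hyw ((dvd_pow hy two_ne_zero).mul_left a')) (dvd_mul_left (l:ℤ) b)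
          exact dvd_cast this (by ring)) (by norm_num) 3
      refine ⟨0, 0, l, w', 4, ?_, ?_⟩
      · obtain ⟨k, hk⟩ := hw1
        exact ⟨-k, by linear_combination -l * hk⟩
      · have := cancel 3 (8 * a' * b * b) (nd (nd (nd h8 ha') hlb) hlb)
        intro h
        exact this (dvd_cast h (by ring))
    · obtain ⟨y', hy1, hy2⟩ := hensel_sq l hl a' y (-d' - a' * b * w ^ 2) 1 0
        (by rw [zero_add, pow_one]; exact nd (nd h2 ha') hy)
        (by rw [pow_one]; exact dvd_cast hyw (by ring)) (by norm_num) 2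
      have hy' : ¬ (l:ℤ) ∣ y' := fun h => hy (by
        have := dvd_sub h (by simpa using hy2)
        simpa using this)
      refine ⟨0, y', 0, w, 3, ?_, ?_⟩
      · obtain ⟨k, hk⟩ := hy1
        exact ⟨-k, by linear_combination -l * hk⟩
      · have := cancel 2 (8 * a' * b * (a' * y' ^ 2)) (nd (nd (nd h8 ha') hlb) (nd ha' (ndp 2 hy')))
        intro h
        exact this (dvd_cast h (by ring))
  · obtain ⟨X, z, hXz⟩ := quad_rep l hl hl2 1 (-b) d (fun h => hpp.not_isUnit (isUnit_of_dvd_one h)) (by rwa [dvd_neg])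
    by_cases hz : (l:ℤ) ∣ z
    · have hX : ¬ (l:ℤ) ∣ X := by
        intro hX
        apply hd
        have := dvd_sub (dvd_add ((dvd_pow hX two_ne_zero).mul_left 1) ((dvd_pow hz two_ne_zero).mul_left (-b))) hXz
        exact dvd_cast this (by ring)
      obtain ⟨X', hX1, -⟩ := hensel_sq l hl 1 X (d + l * a') 1 0
        (by rw [zero_add, pow_one, mul_one]; exact nd h2 hX)
        (by
          rw [pow_one]
          have := dvd_add (dvd_sub hXz ((dvd_pow hz two_ne_zero).mul_left (-b))) (dvd_mul_right (l:ℤ) (-a'))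
          exact dvd_cast this (by ring)) (by norm_num) 3
      refine ⟨X', 1, 0, 0, 3, dvd_cast hX1 (by ring), ?_⟩
      have := cancel 2 (8 * a' * b * a') (nd (nd (nd h8 ha') hlb) ha')
      intro h
      exact this (dvd_cast h (by ring))
    · obtain ⟨z', hz1, hz2⟩ := hensel_sq l hl (-b) z (d - X ^ 2) 1 0
        (by rw [zero_add, pow_one]; exact nd (nd h2 (by rwa [dvd_neg])) hz)
        (by rw [pow_one]; exact dvd_cast hXz (by ring)) (by norm_num) 2
      have hz' : ¬ (l:ℤ) ∣ z' := fun h => hz (by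
        have := dvd_sub h (by simpa using hz2)
        simpa using this)
      refine ⟨X, 0, z', 0, 2, dvd_cast hz1 (by ring), ?_⟩
      have := cancel 1 (8 * a' * b * (b * z' ^ 2)) (nd (nd (nd h8 ha') hlb) (nd hlb (ndp 2 hz')))
      intro h
      exact this (dvd_cast h (by ring))

theorem two_lift (c r : ℤ) (hc : c % 2 = 1) (h : (8:ℤ) ∣ c - r) (K : ℕ) :
    ∃ t : ℤ, (2:ℤ) ^ K ∣ c * t ^ 2 - r ∧ t % 2 = 1 := by
  obtain ⟨t, h1, h2⟩ := hensel_sq 2 Nat.prime_two c 1 r 3 1 (by norm_num; omega) (by norm_num; exact h) (by norm_num) K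
  refine ⟨t, by simpa using h1, ?_⟩
  norm_num at h2
  omega

theorem odd_cancel2 (k : ℕ) (x : ℤ) (hx : x % 2 = 1) : ¬ (2:ℤ) ^ (k + 1) ∣ (2:ℤ) ^ k * x := by
  intro h
  rw [pow_succ] at h
  have := (mul_dvd_mul_iff_left (pow_ne_zero k (two_ne_zero))).1 h
  omega

theorem odd_mul {x y : ℤ} (hx : x % 2 = 1) (hy : y % 2 = 1) : (x * y) % 2 = 1 := by
  rw [Int.mul_emod, hx, hy]; rfl

theorem locSol_P1 (a b d : ℤ) (ha : 0 < a) (hb : 0 < b) (y z w : ℤ) (hN : 0 < a * y ^ 2 + b * z ^ 2)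
    (h : (8:ℤ) ∣ 1 - (d + a * y ^ 2 + b * z ^ 2 + a * b * w ^ 2)) : LocSol a b d 2 := by
  obtain ⟨K, hK⟩ : ∃ K : ℕ, 8 * a * b * (a * y ^ 2 + b * z ^ 2) < 2 ^ K := by
    refine ⟨(8 * a * b * (a * y ^ 2 + b * z ^ 2)).toNat, ?_⟩
    have h1 : ((8 * a * b * (a * y ^ 2 + b * z ^ 2)).toNat : ℤ) = 8 * a * b * (a * y ^ 2 + b * z ^ 2) :=
      Int.toNat_of_nonneg (by positivity)
    have h2 : ((8 * a * b * (a * y ^ 2 + b * z ^ 2)).toNat : ℤ) < 2 ^ (8 * a * b * (a * y ^ 2 + b * z ^ 2)).toNat := by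
      exact_mod_cast Nat.lt_two_pow_self
    linarith
  obtain ⟨X, hX, -⟩ := two_lift 1 _ (by norm_num) h K
  refine ⟨X, y, z, w, K, by push_cast; exact dvd_cast hX (by ring), ?_⟩
  intro h'
  have := Int.le_of_dvd (by positivity) h'
  push_cast at this
  linarith

theorem locSol_P2 (a b d : ℤ) (ha : a % 2 = 1) (hb : b % 4 ≠ 0) (X w : ℤ)
    (h : (8:ℤ) ∣ a - (X ^ 2 - d - a * b * w ^ 2)) : LocSol a b d 2 := by
  obtain ⟨y, hy, hy2⟩ := two_lift a _ ha h 5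
  have ho : (a * (a * y ^ 2)) % 2 = 1 := odd_mul ha (odd_mul ha (by rw [sq]; exact odd_mul hy2 hy2))
  refine ⟨X, y, 0, w, 5, by push_cast; rw [← dvd_neg]; exact dvd_cast hy (by ring), ?_⟩
  intro h'
  have h1 : (32:ℤ) ∣ 8 * (b * (a * (a * y ^ 2))) := dvd_cast h' (by ring)
  have h2 : (4:ℤ) ∣ b * (a * (a * y ^ 2)) := by omega
  have h3 : IsCoprime (4:ℤ) (a * (a * y ^ 2)) := by
    have : IsCoprime (2:ℤ) (a * (a * y ^ 2)) := by
      have := prime_coprime_of_not_dvd Nat.prime_two (x := a * (a * y ^ 2)) (by push_cast; omega)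
      simpa using this
    have := this.pow_left (m := 2)
    norm_num at this
    exact this
  have := h3.dvd_of_dvd_mul_right h2
  omega

theorem locSol_P3 (a b d : ℤ) (ha : a % 2 = 1) (hb : b % 2 = 1) (X z : ℤ)
    (h : (8:ℤ) ∣ a - (2 * X ^ 2 - d - b * (2 * z) ^ 2)) : LocSol (2 * a) (2 * b) (2 * d) 2 := by
  obtain ⟨y, hy, hy2⟩ := two_lift a _ ha h 6
  refine ⟨2 * X, y, 2 * z, 0, 7, ?_, ?_⟩
  · obtain ⟨k, hk⟩ := hy
    refine ⟨-k, ?_⟩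
    push_cast
    linear_combination -2 * hk
  · have ho : (a * y ^ 2) % 2 = 1 := odd_mul ha (by rw [sq]; exact odd_mul hy2 hy2)
    have := odd_cancel2 6 (a * b * (a * y ^ 2 + 2 * (2 * b * z ^ 2))) (odd_mul (odd_mul ha hb) (by omega))
    intro h'
    apply this
    push_cast at h'
    exact dvd_cast h' (by ring)

theorem locSol_P4 (a b d : ℤ) (ha : a % 2 = 1) (hb : b % 2 = 1) (X y w : ℤ)
    (h : (8:ℤ) ∣ b - (2 * X ^ 2 - 2 * a * y ^ 2 - a * b * w ^ 2 - d)) : LocSol a (2 * b) (2 * d) 2 := by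
  obtain ⟨z, hz, hz2⟩ := two_lift b _ hb h 5
  refine ⟨2 * X, 2 * y, z, w, 6, ?_, ?_⟩
  · obtain ⟨k, hk⟩ := hz
    refine ⟨-k, ?_⟩
    push_cast
    linear_combination -2 * hk
  · have ho : (b * z ^ 2) % 2 = 1 := odd_mul hb (by rw [sq]; exact odd_mul hz2 hz2)
    have := odd_cancel2 5 (a * b * (b * z ^ 2 + 2 * (a * y ^ 2))) (odd_mul (odd_mul ha hb) (by omega))
    intro h'
    apply this
    push_cast at h'
    exact dvd_cast h' (by ring)

/-- `a` odd, `b` even. -/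
theorem locSol_two_oe (a b d : ℤ) (ha : a % 2 = 1) (hb : b % 4 = 2) (hd : d % 4 ≠ 0) : LocSol a b d 2 := by
  obtain ⟨b, rfl⟩ : ∃ b', b = 2 * b' := ⟨b / 2, by omega⟩
  have hb' : b % 2 = 1 := by omega
  have hab := odd_mul ha hb'
  have hba := odd_mul hb' ha
  rcases Int.emod_two_eq_zero_or_one d with hd2 | hd2
  · obtain ⟨d, rfl⟩ : ∃ d', d = 2 * d' := ⟨d / 2, by omega⟩
    have hP := fun X y w => locSol_P4 a b d ha hb' X y w
    by_cases k0 : (b + d) % 8 = 0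
    · exact hP 0 0 0 (by ring_nf; omega)
    by_cases k2 : (b + d) % 8 = 2
    · exact hP 1 0 0 (by ring_nf; omega)
    by_cases k4 : (b + d) % 8 = 4
    · exact hP 0 0 2 (by ring_nf; omega)
    · exact hP 1 0 2 (by ring_nf; omega)
  · have hP := fun X w => locSol_P2 a (2 * b) d ha (by omega) X w
    by_cases k0 : (a + d) % 8 = 0
    · exact hP 0 0 (by ring_nf; omega)
    by_cases k4 : (a + d) % 8 = 4
    · exact hP 2 0 (by ring_nf; omega)
    by_cases k : (a + d + 2 * (a * b)) % 8 = 0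
    · exact hP 0 1 (by ring_nf; omega)
    · exact hP 2 1 (by ring_nf; omega)

theorem locSol_two_ee (a b d : ℤ) (ha0 : 0 < a) (hb0 : 0 < b) (ha : a % 4 = 2) (hb : b % 4 = 2) (hd : d % 4 ≠ 0) :
    LocSol a b d 2 := by
  rcases Int.emod_two_eq_zero_or_one d with hd2 | hd2
  · obtain ⟨a, rfl⟩ : ∃ b', a = 2 * b' := ⟨a / 2, by omega⟩
    obtain ⟨b, rfl⟩ : ∃ c', b = 2 * c' := ⟨b / 2, by omega⟩
    obtain ⟨d, rfl⟩ : ∃ d', d = 2 * d' := ⟨d / 2, by omega⟩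
    have ha' : a % 2 = 1 := by omega
    have hb' : b % 2 = 1 := by omega
    have hP := fun X z => locSol_P3 a b d ha' hb' X z
    by_cases k0 : (a + d) % 8 = 0
    · exact hP 0 0 (by ring_nf; omega)
    by_cases k2 : (a + d) % 8 = 2
    · exact hP 1 0 (by ring_nf; omega)
    by_cases k4 : (a + d) % 8 = 4
    · exact hP 0 1 (by ring_nf; omega)
    · exact hP 1 1 (by ring_nf; omega)
  · have hP := fun y z w => locSol_P1 a b d ha0 hb0 y z w
    have hab : (a * b) % 8 = 4 := by
      obtain ⟨i, rfl⟩ : ∃ i, a = 4 * i + 2 := ⟨a / 4, by omega⟩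
      obtain ⟨j, rfl⟩ : ∃ j, b = 4 * j + 2 := ⟨b / 4, by omega⟩
      ring_nf; omega
    by_cases k1 : d % 8 = 1
    · exact hP 2 0 0 (by positivity) (by ring_nf; omega)
    by_cases k5 : d % 8 = 5
    · exact hP 2 0 1 (by positivity) (by ring_nf; omega)
    by_cases k : (d + a) % 8 = 1
    · exact hP 1 0 0 (by positivity) (by ring_nf; omega)
    · exact hP 1 0 1 (by positivity) (by ring_nf; omega)

theorem locSol_two_oo (a b d : ℤ) (ha0 : 0 < a) (hb0 : 0 < b) (ha : a % 2 = 1) (hb : b % 2 = 1) (hd : d % 4 ≠ 0) :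
    LocSol a b d 2 := by
  have hP1 := fun y z w => locSol_P1 a b d ha0 hb0 y z w
  have hP2 := fun X w => locSol_P2 a b d ha (by omega) X w
  have hP2s := fun X w h => (locSol_P2 b a d hb (by omega) X w h).swap
  have hab := odd_mul ha hb
  rcases Int.emod_two_eq_zero_or_one d with hd2 | hd2
  · by_cases k1 : a % 4 = 3
    · by_cases k : (d + a) % 8 = 1
      · exact hP1 1 0 0 (by positivity) (by ring_nf; omega)
      · exact hP1 1 0 2 (by positivity) (by ring_nf; omega)
    by_cases k2 : b % 4 = 3
    · by_cases k : (d + b) % 8 = 1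
      · exact hP1 0 1 0 (by positivity) (by ring_nf; omega)
      · exact hP1 0 1 2 (by positivity) (by ring_nf; omega)
    have hab : (a * b) % 4 = 1 := by
      obtain ⟨i, rfl⟩ : ∃ i, a = 4 * i + 1 := ⟨a / 4, by omega⟩
      obtain ⟨j, rfl⟩ : ∃ j, b = 4 * j + 1 := ⟨b / 4, by omega⟩
      ring_nf; omega
    by_cases k : (a + d + a * b) % 8 = 0
    · exact hP2 0 1 (by ring_nf; omega)
    · exact hP2 2 1 (by ring_nf; omega)
  · by_cases k0 : (a + d) % 8 = 0
    · exact hP2 0 0 (by ring_nf; omega)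
    by_cases k4 : (a + d) % 8 = 4
    · exact hP2 2 0 (by ring_nf; omega)
    by_cases m0 : (b + d) % 8 = 0
    · exact hP2s 0 0 (by ring_nf; omega)
    by_cases m4 : (b + d) % 8 = 4
    · exact hP2s 2 0 (by ring_nf; omega)
    by_cases k1 : d % 4 = 1
    · by_cases k : d % 8 = 1
      · exact hP1 2 2 0 (by positivity) (by ring_nf; omega)
      · exact hP1 2 0 0 (by positivity) (by ring_nf; omega)
    · by_cases k : (d + a + b) % 8 = 1
      · exact hP1 1 1 0 (by positivity) (by ring_nf; omega)
      · exact hP1 1 1 2 (by positivity) (by ring_nf; omega)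

theorem locSol_all (a b d : ℤ) (ha : Squarefree a) (hb : Squarefree b) (hapos : 0 < a) (hbpos : 0 < b)
    (hgcd : Int.gcd a b ≤ 2) (hd : Squarefree d) (l : ℕ) (hl : l.Prime) (hlab : (l:ℤ) ∣ 2 * a * b) : LocSol a b d l := by
  have hpp := Nat.prime_iff_prime_int.1 hl
  have sf : ∀ {x : ℤ}, Squarefree x → ¬ (l:ℤ) ^ 2 ∣ x := fun h h' => by
    rw [sq] at h'
    exact hpp.not_isUnit (h _ h')
  by_cases hl2 : l = 2
  · subst hl2
    have h4 : ∀ {x : ℤ}, Squarefree x → x % 4 ≠ 0 := fun h h' => sf h (by norm_num; omega)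
    have ha4 := h4 ha
    have hb4 := h4 hb
    have hd4 := h4 hd
    rcases Int.emod_two_eq_zero_or_one a with h1 | h1 <;> rcases Int.emod_two_eq_zero_or_one b with h2 | h2
    · exact locSol_two_ee a b d hapos hbpos (by omega) (by omega) hd4
    · exact (locSol_two_oe b a d h2 (by omega) hd4).swap
    · exact locSol_two_oe a b d h1 (by omega) hd4
    · exact locSol_two_oo a b d hapos hbpos h1 h2 hd4
  · have h2 : ¬ (l:ℤ) ∣ 2 := fun h => hl2 ((Nat.prime_dvd_prime_iff_eq hl Nat.prime_two).1 (by exact_mod_cast h))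
    have hnot : (l:ℤ) ∣ a → (l:ℤ) ∣ b → False := by
      intro h1 h3
      have h4 : (l:ℤ) ∣ (Int.gcd a b : ℤ) := Int.dvd_coe_gcd h1 h3
      have h5 : l ∣ Int.gcd a b := by exact_mod_cast h4
      have h6 : 0 < Int.gcd a b := Int.gcd_pos_of_ne_zero_left _ hapos.ne'
      have := Nat.le_of_dvd h6 h5
      have := hl.two_le
      omega
    rcases hpp.dvd_or_dvd hlab with h | h
    · rcases hpp.dvd_or_dvd h with h | h
      · exact absurd h h2
      · exact locSol_odd a b d l hl hl2 h (sf ha) (hnot h) (sf hd)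
    · exact (locSol_odd b a d l hl hl2 h (sf hb) (fun h' => hnot h' h) (sf hd)).swap


theorem crt_fin (s : Finset ℕ) (hs : ∀ l ∈ s, l.Prime) (K : ℕ → ℕ) (r : ℕ → ℤ) :
    ∃ t : ℤ, ∀ l ∈ s, (l:ℤ) ^ K l ∣ t - r l := by
  classical
  induction s using Finset.induction_on with
  | empty => exact ⟨0, by simp⟩
  | insert q s hq ih =>
    obtain ⟨t0, ht0⟩ := ih (fun l hl => hs l (Finset.mem_insert_of_mem hl))
    have hqp := hs q (Finset.mem_insert_self _ _)
    have hne : (∏ l ∈ s, (l:ℤ) ^ K l) ≠ 0 := Finset.prod_ne_zero_iff.2 fun l hl =>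
      pow_ne_zero _ (by exact_mod_cast (hs l (Finset.mem_insert_of_mem hl)).ne_zero)
    have hcop : IsCoprime ((q:ℤ) ^ K q) (∏ l ∈ s, (l:ℤ) ^ K l) := by
      refine IsCoprime.prod_right fun l hl => IsCoprime.pow ?_
      rw [Nat.isCoprime_iff_coprime]
      exact (Nat.coprime_primes hqp (hs l (Finset.mem_insert_of_mem hl))).2 (fun h => hq (h ▸ hl))
    obtain ⟨t, -, h1, h2⟩ := crt_pos _ _ (r q) t0 (pow_ne_zero _ (by exact_mod_cast hqp.ne_zero)) hne hcop 0
    refine ⟨t, fun l hl => ?_⟩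
    rcases Finset.mem_insert.1 hl with rfl | hl
    · exact h1
    · have h3 : (l:ℤ) ^ K l ∣ t - t0 := (Finset.dvd_prod_of_mem (fun l : ℕ => (l:ℤ) ^ K l) hl).trans h2
      exact dvd_cast (dvd_add h3 (ht0 l hl)) (by ring)

theorem split_part (P : ℤ) : ∀ (k : ℕ) (N : ℤ), N.natAbs = k → 0 < N →
    ∃ (c N1 : ℤ) (j : ℕ), N = c * N1 ∧ 0 < c ∧ 0 < N1 ∧ c ∣ P ^ j ∧ IsCoprime N1 P := by
  intro k
  induction k using Nat.strong_induction_on with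
  | _ k ih =>
    intro N hk hN
    by_cases hc : ∃ r : ℕ, r.Prime ∧ (r:ℤ) ∣ N ∧ (r:ℤ) ∣ P
    · obtain ⟨r, hr, ⟨N', rfl⟩, hrP⟩ := hc
      have hr0 : (0:ℤ) < r := by exact_mod_cast hr.pos
      have hr2 : (2:ℤ) ≤ r := by exact_mod_cast hr.two_le
      have hN' : 0 < N' := pos_of_mul_pos_right hN hr0.le
      have hlt : N' < r * N' := by nlinarith only [hr2, hN']
      obtain ⟨c, N1, j, h1, h2, h3, h4, h5⟩ := ih N'.natAbs (by
        rw [← hk]; exact Int.natAbs_lt_natAbs_of_nonneg_of_lt hN'.le hlt) N' rfl hN'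
      refine ⟨r * c, N1, j + 1, by rw [mul_assoc, ← h1], by positivity, h3, ?_, h5⟩
      rw [pow_succ, mul_comm]
      exact mul_dvd_mul h4 hrP
    · exact ⟨1, N, 0, by ring, one_pos, hN, one_dvd _, isCoprime_of_primes _ _ fun r hr h1 h2 => hc ⟨r, hr, h1, h2⟩⟩

theorem dvd_of_local (m x : ℤ)
    (h : ∀ l : ℕ, l.Prime → (l:ℤ) ∣ m → ∃ K : ℕ, (l:ℤ) ^ K ∣ x ∧ ¬ (l:ℤ) ^ K ∣ m) : m ∣ x := by
  rw [← Int.natAbs_dvd_natAbs, Nat.dvd_iff_prime_pow_dvd_dvd]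
  intro p k hp hk
  have cv : ∀ (j : ℕ) (y : ℤ), p ^ j ∣ y.natAbs ↔ (p:ℤ) ^ j ∣ y := fun j y => by
    rw [← Int.natCast_dvd]; push_cast; rfl
  rw [cv] at hk ⊢
  rcases Nat.eq_zero_or_pos k with rfl | hk0
  · simp
  obtain ⟨K, h1, h2⟩ := h p hp ((dvd_pow_self _ hk0.ne').trans hk)
  have : k ≤ K := by
    by_contra hlt
    exact h2 ((pow_dvd_pow _ (by omega)).trans hk)
  exact (pow_dvd_pow _ this).trans h1

theorem qf4 (a b : ℤ) (v : Fin 4 → ℤ) : qf ![1, -a, -b, -(a * b)] v = v 0 ^ 2 - a * v 1 ^ 2 - b * v 2 ^ 2 - a * b * v 3 ^ 2 := by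
  simp [qf, Fin.sum_univ_four]; ring

theorem locSol_lift {a b d : ℤ} {l : ℕ} (hl : l.Prime) (h : LocSol a b d l) (K' : ℕ) :
    ∃ y : Fin 4 → ℤ, (l:ℤ) ^ K' ∣ qf ![1, -a, -b, -(a * b)] y - d := by
  obtain ⟨X, y, z, w, K, h1, h2⟩ := h
  have hK : 0 < K := by
    rcases Nat.eq_zero_or_pos K with rfl | h
    · simp at h2
    · exact h
  have hh : ¬ (l:ℤ) ^ ((K - 1) / 2 + 1) ∣ 2 * a * y ∨ ¬ (l:ℤ) ^ ((K - 1) / 2 + 1) ∣ 2 * b * z := by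
    by_contra hcon
    push Not at hcon
    obtain ⟨⟨k1, e1⟩, ⟨k2, e2⟩⟩ := hcon
    apply h2
    have : (l:ℤ) ^ K ∣ ((l:ℤ) ^ ((K - 1) / 2 + 1)) ^ 2 := by
      rw [← pow_mul]; exact pow_dvd_pow _ (by omega)
    refine this.trans ⟨2 * b * k1 ^ 2 + 2 * a * k2 ^ 2, ?_⟩
    linear_combination 2 * b * (2 * a * y + (l:ℤ) ^ ((K - 1) / 2 + 1) * k1) * e1 + 2 * a * (2 * b * z + (l:ℤ) ^ ((K - 1) / 2 + 1) * k2) * e2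
  have h3 : (l:ℤ) ^ K ∣ qf ![1, -a, -b, -(a * b)] ![X, y, z, w] - d := by
    rw [qf4]; simpa using h1
  rcases hh with hh | hh
  · obtain ⟨Y, hY, -⟩ := hensel_qf ![1, -a, -b, -(a * b)] l hl d ![X, y, z, w] 1 K ((K - 1) / 2) (by
      simpa using hh) h3 (by omega) K'
    exact ⟨Y, hY⟩
  · obtain ⟨Y, hY, -⟩ := hensel_qf ![1, -a, -b, -(a * b)] l hl d ![X, y, z, w] 2 K ((K - 1) / 2) (by
      simpa using hh) h3 (by omega) K'
    exact ⟨Y, hY⟩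

theorem rational_rep (a b d : ℤ) (ha : 0 < a) (hb : 0 < b) (hab : 1 < a * b)
    (hloc : ∀ l : ℕ, l.Prime → (l:ℤ) ∣ 2 * a * b → LocSol a b d l) :
    ∃ (u : Fin 4 → ℤ) (m : ℤ), m ≠ 0 ∧ qf ![1, -a, -b, -(a * b)] u = d * m ^ 2 := by
  classical
  have hloc' : ∀ l : ℕ, ∃ (X y z w : ℤ) (K : ℕ), l.Prime → (l:ℤ) ∣ 2 * a * b →
      (l:ℤ) ^ K ∣ X ^ 2 - a * y ^ 2 - b * z ^ 2 - a * b * w ^ 2 - d ∧ ¬ (l:ℤ) ^ K ∣ 8 * a * b * (a * y ^ 2 + b * z ^ 2) := by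
    intro l
    by_cases h : l.Prime ∧ (l:ℤ) ∣ 2 * a * b
    · obtain ⟨X, y, z, w, K, h1⟩ := hloc l h.1 h.2
      exact ⟨X, y, z, w, K, fun _ _ => h1⟩
    · exact ⟨0, 0, 0, 0, 0, fun h1 h2 => absurd ⟨h1, h2⟩ h⟩
  choose lX ly lz lw K hK using hloc'
  have hP0 : 2 * a * b ≠ 0 := by positivity
  set s := (2 * a * b).natAbs.primeFactors with hs
  have hmem : ∀ l : ℕ, l ∈ s ↔ l.Prime ∧ (l:ℤ) ∣ 2 * a * b := by
    intro l
    rw [hs, Nat.mem_primeFactors, Int.natCast_dvd]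
    simp only [ne_eq, Int.natAbs_eq_zero, hP0, not_false_eq_true, and_true]
  have hsp : ∀ l ∈ s, l.Prime := fun l hl => ((hmem l).1 hl).1
  obtain ⟨X0, hX0⟩ := crt_fin s hsp K lX
  obtain ⟨y0, hy0⟩ := crt_fin s hsp K ly
  obtain ⟨z0, hz0⟩ := crt_fin s hsp K lz
  obtain ⟨w, hw⟩ := crt_fin s hsp K lw
  set M : ℤ := ∏ l ∈ s, (l:ℤ) ^ K l with hM
  have hMpos : 0 < M := Finset.prod_pos fun l hl => pow_pos (by exact_mod_cast (hsp l hl).pos) _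
  have hMd : ∀ l ∈ s, (l:ℤ) ^ K l ∣ M := fun l hl => Finset.dvd_prod_of_mem (fun l : ℕ => (l:ℤ) ^ K l) hl
  have hrM : ∀ r : ℕ, r.Prime → ¬ (r:ℤ) ∣ 2 * a * b → ¬ (r:ℤ) ∣ M := by
    intro r hr h1 h2
    obtain ⟨l, hl, h3⟩ := (Prime.dvd_finsetProd_iff (Nat.prime_iff_prime_int.1 hr) _).1 h2
    have h4 := (Nat.prime_iff_prime_int.1 hr).dvd_of_dvd_pow h3
    have h5 : r = l := (Nat.prime_dvd_prime_iff_eq hr (hsp l hl)).1 (by exact_mod_cast h4)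
    exact h1 (h5 ▸ ((hmem l).1 hl).2)
  clear_value M
  obtain ⟨z, hz⟩ : ∃ z, z = z0 + M * (|z0| + 1) := ⟨_, rfl⟩
  have hzpos : 0 < z := by
    rw [hz]
    have := neg_abs_le z0
    have := abs_nonneg z0
    nlinarith
  obtain ⟨j, -, hj⟩ := coprime_trick y0 M z hzpos.ne'
  obtain ⟨y, hy⟩ : ∃ y, y = y0 + M * j := ⟨_, rfl⟩
  rw [← hy] at hj
  obtain ⟨X, hX⟩ : ∃ X, X = X0 + M * (|X0| + |d| + 1) := ⟨_, rfl⟩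
  have hXd : 0 < X ^ 2 - d := by
    have h1 := neg_abs_le X0
    have h2 := abs_nonneg X0
    have h3 := le_abs_self d
    have h4 := abs_nonneg d
    have h5 : |d| + 1 ≤ X := by rw [hX]; nlinarith
    nlinarith
  have hNpos : 0 < a * y ^ 2 + b * z ^ 2 := by positivity
  obtain ⟨c, N1, k, hN, hc, hN1, hck, hN1P⟩ := split_part (2 * a * b) _ (a * y ^ 2 + b * z ^ 2) rfl hNpos
  have hzN1 : IsCoprime z N1 := by
    refine isCoprime_of_primes _ _ fun r hr h1 h2 => ?_
    have hpp := Nat.prime_iff_prime_int.1 hr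
    have h3 : ¬ (r:ℤ) ∣ 2 * a * b := not_dvd_of_isCoprime hN1P hr h2
    have h4 : ¬ (r:ℤ) ∣ a := fun h => h3 ((h.mul_left 2).mul_right b)
    refine hj r hr h1 (hrM r hr h3) ?_
    have h5 : (r:ℤ) ∣ a * y ^ 2 := by
      have h6 : (r:ℤ) ∣ a * y ^ 2 + b * z ^ 2 := hN ▸ h2.mul_left c
      exact dvd_cast (dvd_sub h6 ((dvd_pow h1 two_ne_zero).mul_left b)) (by ring)
    exact hpp.dvd_of_dvd_pow ((hpp.dvd_or_dvd h5).resolve_left h4)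
  have hdv : 8 * a * b * c ∣ c * N1 + a * b * w ^ 2 - (X ^ 2 - d) := by
    refine dvd_of_local _ _ fun l hl hlm => ?_
    have hpp := Nat.prime_iff_prime_int.1 hl
    have hl2 : (l:ℤ) ∣ 2 * a * b := by
      rcases hpp.dvd_or_dvd hlm with h | h
      · have : (l:ℤ) ∣ (2 * a * b) ^ 3 := h.trans ⟨a ^ 2 * b ^ 2, by ring⟩
        exact hpp.dvd_of_dvd_pow this
      · exact hpp.dvd_of_dvd_pow (h.trans hck)
    have hls : l ∈ s := (hmem l).2 ⟨hl, hl2⟩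
    obtain ⟨k1, k2⟩ := hK l hl hl2
    have eX : (l:ℤ) ^ K l ∣ X - lX l := dvd_cast (dvd_add (hX0 l hls) ((hMd l hls).mul_right (|X0| + |d| + 1))) (by rw [hX]; ring)
    have ey : (l:ℤ) ^ K l ∣ y - ly l := dvd_cast (dvd_add (hy0 l hls) ((hMd l hls).mul_right j)) (by rw [hy]; ring)
    have ez : (l:ℤ) ^ K l ∣ z - lz l := dvd_cast (dvd_add (hz0 l hls) ((hMd l hls).mul_right (|z0| + 1))) (by rw [hz]; ring)
    have ew := hw l hls
    have sqd : ∀ {x x' : ℤ}, (l:ℤ) ^ K l ∣ x - x' → (l:ℤ) ^ K l ∣ x ^ 2 - x' ^ 2 := fun {x x'} h => h.trans ⟨x + x', by ring⟩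
    refine ⟨K l, ?_, ?_⟩
    · have t1 := dvd_add k1 (sqd eX)
      have t2 := dvd_sub t1 ((sqd ey).mul_left a)
      have t3 := dvd_sub t2 ((sqd ez).mul_left b)
      have t4 := dvd_sub t3 ((sqd ew).mul_left (a * b))
      rw [← dvd_neg]
      exact dvd_cast t4 (by linear_combination hN)
    · intro h
      apply k2
      have t1 : (l:ℤ) ^ K l ∣ 8 * a * b * (a * y ^ 2 + b * z ^ 2) := h.trans ⟨N1, by rw [hN]; ring⟩
      have t2 := dvd_sub t1 (((sqd ey).mul_left a).mul_left (8 * a * b))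
      have t3 := dvd_sub t2 (((sqd ez).mul_left b).mul_left (8 * a * b))
      exact dvd_cast t3 (by ring)
  obtain ⟨y', z', w', t, ht, hrep⟩ := ternary_rational a b (X ^ 2 - d) y z w c N1 k ha hb hab hXd hN hc hck hN1 hN1P hzN1 hdv
  refine ⟨![X * t, y', z', w'], t, ht, ?_⟩
  rw [qf4]
  simp
  linear_combination -hrep

theorem good_rep (a b d : ℤ) (ha : 0 < a) (hb : 0 < b) (hab : 1 < a * b) (hd : d ≠ 0)
    (hloc : ∀ l : ℕ, l.Prime → (l:ℤ) ∣ 2 * a * b → LocSol a b d l) (T : Finset ℕ)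
    (hT : ∀ l ∈ T, l.Prime ∧ (l:ℤ) ∣ 2 * a * b) :
    ∃ (u : Fin 4 → ℤ) (m : ℤ), m ≠ 0 ∧ qf ![1, -a, -b, -(a * b)] u = d * m ^ 2 ∧ IsCoprime m (∏ l ∈ T, (l:ℤ)) := by
  classical
  induction T using Finset.induction_on with
  | empty =>
    obtain ⟨u, m, h1, h2⟩ := rational_rep a b d ha hb hab hloc
    exact ⟨u, m, h1, h2, by simpa using isCoprime_one_right⟩
  | insert q T hq ih =>
    obtain ⟨u, m, h1, h2, h3⟩ := ih (fun l hl => hT l (Finset.mem_insert_of_mem hl))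
    obtain ⟨hqp, hqd⟩ := hT q (Finset.mem_insert_self _ _)
    have hcop : IsCoprime (q:ℤ) (∏ l ∈ T, (l:ℤ)) := by
      refine IsCoprime.prod_right fun l hl => ?_
      rw [Nat.isCoprime_iff_coprime]
      exact (Nat.coprime_primes hqp (hT l (Finset.mem_insert_of_mem hl)).1).2 (fun h => hq (h ▸ hl))
    obtain ⟨U, m', k1, k2, k3, -⟩ := weak_approx ![1, -a, -b, -(a * b)] u d m h2 h1 hd q hqp _ h3 hcop ![1, 0, 0, 0]
      (by rw [qf4]; simpa using isCoprime_one_left) 0 0 (fun K => by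
        obtain ⟨y, hy⟩ := locSol_lift hqp (hloc q hqp hqd) K
        exact ⟨y, hy, by simp⟩)
    refine ⟨U, m', fun h => k3 (h ▸ dvd_zero _), k1, ?_⟩
    rw [Finset.prod_insert hq]
    exact IsCoprime.mul_right (prime_coprime_of_not_dvd hqp k3).symm k2

theorem descend (a b : ℤ) (ha : 0 < a) (hb : 0 < b) (hab : 1 < a * b) (d : ℤ) : ∀ (k : ℕ) (m : ℤ), m.natAbs = k → m ≠ 0 →
    (∀ r : ℕ, r.Prime → (r:ℤ) ∣ m → ¬ (r:ℤ) ∣ 2 * a * b) →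
    (∃ x y z w : ℤ, x ^ 2 - a * y ^ 2 - b * z ^ 2 - a * b * w ^ 2 = d * m ^ 2) →
    ∃ x y z w : ℤ, x ^ 2 - a * y ^ 2 - b * z ^ 2 - a * b * w ^ 2 = d := by
  intro k
  induction k using Nat.strong_induction_on with
  | _ k ih =>
    intro m hk hm0 hr hrep
    by_cases h1 : m.natAbs = 1
    · have : m ^ 2 = 1 := by rw [← Int.natAbs_sq, h1]; rfl
      rwa [this, mul_one] at hrep
    · obtain ⟨p, hp, hpm⟩ := Nat.exists_prime_and_dvd h1
      obtain ⟨m', rfl⟩ := Int.natCast_dvd.2 hpm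
      obtain ⟨x, y, z, w, h⟩ := hrep
      have h2 := remove_prime a b ha hb hab p hp (hr p hp (dvd_mul_right _ _)) (d * m' ^ 2) x y z w (by rw [h]; ring)
      have hm' : m' ≠ 0 := right_ne_zero_of_mul hm0
      refine ih m'.natAbs ?_ m' rfl hm' (fun r hr1 hr2 => hr r hr1 (hr2.mul_left _)) h2
      rw [← hk, Int.natAbs_mul, Int.natAbs_natCast]
      have := hp.two_le
      have : 0 < m'.natAbs := Int.natAbs_pos.2 hm'
      nlinarith

theorem universal_sqfree (a b : ℤ) (ha : Squarefree a) (hb : Squarefree b)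
    (hapos : 0 < a) (hbpos : 0 < b) (hgcd : Int.gcd a b ≤ 2) (d : ℤ) (hd : Squarefree d) (hab : 1 < a * b) :
    ∃ x y z w : ℤ, x ^ 2 - a * y ^ 2 - b * z ^ 2 - a * b * w ^ 2 = d := by
  have hP0 : 2 * a * b ≠ 0 := by positivity
  have hmem : ∀ l : ℕ, l ∈ (2 * a * b).natAbs.primeFactors ↔ l.Prime ∧ (l:ℤ) ∣ 2 * a * b := by
    intro l
    rw [Nat.mem_primeFactors, Int.natCast_dvd]
    simp only [ne_eq, Int.natAbs_eq_zero, hP0, not_false_eq_true, and_true]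
  obtain ⟨u, m, h1, h2, h3⟩ := good_rep a b d hapos hbpos hab hd.ne_zero
    (fun l hl hl2 => locSol_all a b d ha hb hapos hbpos hgcd hd l hl hl2) _ (fun l hl => (hmem l).1 hl)
  refine descend a b hapos hbpos hab d _ m rfl h1 (fun r hr hrm hrP => ?_) ⟨u 0, u 1, u 2, u 3, by rw [← qf4]; exact h2⟩
  exact not_dvd_of_isCoprime h3 hr hrm (Finset.dvd_prod_of_mem (fun l : ℕ => (l:ℤ)) ((hmem r).2 ⟨hr, hrP⟩))

theorem stmt_12 (a b : ℤ) (ha : Squarefree a) (hb : Squarefree b)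
    (hapos : 0 < a) (hbpos : 0 < b) (hgcd : Int.gcd a b ≤ 2) (d : ℤ) :
    ∃ x₀ y₁ y₂ y₃ : ℤ,
      x₀ ^ 2 - a * y₁ ^ 2 - b * y₂ ^ 2 - a * b * y₃ ^ 2 = d := by
  by_cases hab : 1 < a * b
  · by_cases hd0 : d = 0
    · exact ⟨0, 0, 0, 0, by rw [hd0]; ring⟩
    obtain ⟨d1, k, h1, h2⟩ := Nat.sq_mul_squarefree d.natAbs
    obtain ⟨D, hD, hDk⟩ : ∃ D : ℤ, Squarefree D ∧ d = D * (k:ℤ) ^ 2 := by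
      rcases Int.natAbs_eq d with h | h
      · refine ⟨d1, ?_, ?_⟩
        · rw [← Int.squarefree_natAbs]; simpa using h2
        · rw [h, ← h1]; push_cast; ring
      · refine ⟨-d1, ?_, ?_⟩
        · rw [← Int.squarefree_natAbs]; simpa using h2
        · rw [h, ← h1]; push_cast; ring
    obtain ⟨x, y, z, w, h⟩ := universal_sqfree a b ha hb hapos hbpos hgcd D hD hab
    exact ⟨k * x, k * y, k * z, k * w, by rw [hDk, ← h]; ring⟩
  · have h1 : a * b = 1 := by
      have : 0 < a * b := by positivity
      omega
    have ha1 : a = 1 := Int.eq_one_of_mul_eq_one_right hapos.le h1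
    have hb1 : b = 1 := by rw [ha1, one_mul] at h1; exact h1
    subst ha1 hb1
    rcases Int.emod_two_eq_zero_or_one d with h | h
    · obtain ⟨e, rfl⟩ : ∃ e, d = 2 * e := ⟨d / 2, by omega⟩
      exact ⟨e + 1, e, 1, 0, by ring⟩
    · obtain ⟨e, rfl⟩ : ∃ e, d = 2 * e + 1 := ⟨d / 2, by omega⟩
      exact ⟨e + 1, e, 0, 0, by ring⟩
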